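/- arXiv:2011.05535 — 6 statements merged into one kernel-verified Lean document; each statement's English description precedes it below -/
import Mathlib

section
/- Let E be a finite field of odd cardinality. Then every square-free polynomial in E[X] is square-reflexive. -/
open Polynomial

/-- `f` is square-reflexive over `E`. -/
def IsSquareReflexive {E : Type*} [Field E] (f : Polynomial E) : Prop :=
  Squarefree f ∧
  ∀ α : (Polynomial E ⧸ Ideal.span {f})ˣ,
    (∃ u : Eˣ, Algebra.norm E (α : Polynomial E ⧸ Ideal.span {f}) = (u : E) ^ 2 ∨
               Algebra.norm E (α : Polynomial E ⧸ Ideal.span {f}) = f.leadingCoeff * (u : E) ^ 2) →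
    ∃ g : Polynomial E, IsCoprime f g ∧
      (∃ β : (Polynomial E ⧸ Ideal.span {f})ˣ,
        Ideal.Quotient.mk (Ideal.span {f}) g
          = (α : Polynomial E ⧸ Ideal.span {f}) * (β : Polynomial E ⧸ Ideal.span {f}) ^ 2) ∧
      IsSquare (Ideal.Quotient.mk (Ideal.span {g}) f)


set_option linter.unusedSectionVars false
set_option linter.style.haveILetI false

namespace SqRefl
variable {E : Type*} [Field E] [Fintype E]

lemma finite_monics (n : ℕ) : {p : E[X] | p.Monic ∧ p.natDegree = n}.Finite := by
  have : Finite (degreeLT E (n+1)) := Module.finite_of_finite E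
  refine Set.Finite.subset (Set.toFinite (degreeLT E (n+1) : Set E[X])) ?_
  rintro p ⟨hp, hn⟩
  simp only [SetLike.mem_coe, mem_degreeLT]
  rw [degree_eq_natDegree hp.ne_zero, hn]
  exact_mod_cast Nat.lt_succ_self n

/-- Monic polynomials of degree `n`. -/
noncomputable def M (E : Type*) [Field E] [Fintype E] (n : ℕ) : Finset E[X] :=
  (finite_monics (E := E) n).toFinset

lemma mem_M {n : ℕ} {p : E[X]} : p ∈ M E n ↔ p.Monic ∧ p.natDegree = n := by simp [M]

open Classical in
/-- Monic divisors. -/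
noncomputable def D (g : E[X]) : Finset E[X] :=
  ((Finset.range (g.natDegree + 1)).biUnion (M E)).filter (· ∣ g)

lemma mem_D {g : E[X]} (hg : g ≠ 0) {a : E[X]} : a ∈ D g ↔ a.Monic ∧ a ∣ g := by
  simp only [D, Finset.mem_filter, Finset.mem_biUnion, Finset.mem_range, mem_M]
  constructor
  · rintro ⟨⟨n, -, h, -⟩, h2⟩; exact ⟨h, h2⟩
  · rintro ⟨h, h2⟩
    exact ⟨⟨a.natDegree, Nat.lt_succ_of_le (natDegree_le_of_dvd h2 hg), h, rfl⟩, h2⟩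

lemma conv (ψ φ : E[X] →* ℤ) (n : ℕ) :
    ∑ g ∈ M E n, ψ g * ∑ a ∈ D g, φ a =
      ∑ i ∈ Finset.range (n+1), (∑ b ∈ M E i, ψ b) * ∑ a ∈ M E (n - i), ψ a * φ a := by
  simp_rw [Finset.mul_sum, Finset.sum_mul]
  simp_rw [Finset.sum_sigma']
  symm
  refine Finset.sum_bij (fun x _ => ⟨x.2.1 * x.2.2, x.2.1⟩) ?_ ?_ ?_ ?_
  · rintro ⟨i, a, b⟩ h
    simp only [Finset.mem_sigma, Finset.mem_range, mem_M] at h ⊢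
    obtain ⟨hi, ⟨ha, ha'⟩, hb, hb'⟩ := h
    refine ⟨⟨ha.mul hb, ?_⟩, ?_⟩
    · rw [ha.natDegree_mul hb]; omega
    · rw [mem_D (ha.mul hb).ne_zero]; exact ⟨ha, dvd_mul_right _ _⟩
  · rintro ⟨i, a, b⟩ h ⟨i', a', b'⟩ h' heq
    simp only [Finset.mem_sigma, Finset.mem_range, mem_M] at h h'
    simp only [Sigma.mk.injEq] at heq
    obtain ⟨h1, h2⟩ := heq
    have h2 := eq_of_heq h2
    subst h2
    have := mul_left_cancel₀ h.2.1.1.ne_zero h1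
    subst this
    have : i = i' := by rw [← h.2.2.2, ← h'.2.2.2]
    subst this
    rfl
  · rintro ⟨g, a⟩ h
    simp only [Finset.mem_sigma, mem_M] at h
    obtain ⟨⟨hg, hn⟩, h⟩ := h
    rw [mem_D hg.ne_zero] at h
    obtain ⟨ha, b, rfl⟩ := h
    have hb : b.Monic := ha.of_mul_monic_left hg
    rw [ha.natDegree_mul hb] at hn
    refine ⟨⟨b.natDegree, a, b⟩, ?_, rfl⟩
    simp only [Finset.mem_sigma, Finset.mem_range, mem_M]
    exact ⟨by omega, ⟨ha, by omega⟩, hb, trivial⟩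
  · rintro ⟨i, a, b⟩ _
    simp only [map_mul]
    ring

lemma sum_D_mul (φ : E[X] →* ℤ) {x y : E[X]} (hx : x ≠ 0) (hy : y ≠ 0) (h : IsCoprime x y) :
    ∑ a ∈ D (x * y), φ a = (∑ a ∈ D x, φ a) * ∑ a ∈ D y, φ a := by
  classical
  rw [Finset.sum_mul_sum, ← Finset.sum_product']
  symm
  refine Finset.sum_bij (fun z _ => z.1 * z.2) ?_ ?_ ?_ ?_
  · rintro ⟨a, b⟩ hab
    simp only [Finset.mem_product, mem_D hx, mem_D hy, mem_D (mul_ne_zero hx hy)] at hab ⊢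
    exact ⟨hab.1.1.mul hab.2.1, mul_dvd_mul hab.1.2 hab.2.2⟩
  · rintro ⟨a, b⟩ hab ⟨a', b'⟩ hab' heq
    simp only [Finset.mem_product, mem_D hx, mem_D hy] at hab hab' heq
    have key : ∀ {a b a' b' : E[X]}, a ∣ x → b' ∣ y → a * b = a' * b' → a ∣ a' := by
      intro a b a' b' h1 h2 h3
      exact ((h.of_isCoprime_of_dvd_left h1).of_isCoprime_of_dvd_right h2).dvd_of_dvd_mul_right
        (h3 ▸ dvd_mul_right a b)
    have e1 : a = a' := eq_of_monic_of_associated hab.1.1 hab'.1.1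
      (associated_of_dvd_dvd (key hab.1.2 hab'.2.2 heq) (key hab'.1.2 hab.2.2 heq.symm))
    subst e1
    have := mul_left_cancel₀ hab.1.1.ne_zero heq
    simp [this]
  · intro c hc
    rw [mem_D (mul_ne_zero hx hy)] at hc
    obtain ⟨a, b, ha, hb, rfl⟩ := exists_dvd_and_dvd_of_dvd_mul hc.2
    have ha0 : a ≠ 0 := ne_zero_of_dvd_ne_zero hx ha
    have hb0 : b ≠ 0 := ne_zero_of_dvd_ne_zero hy hb
    refine ⟨(normalize a, normalize b), ?_, ?_⟩
    · simp only [Finset.mem_product, mem_D hx, mem_D hy]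
      exact ⟨⟨monic_normalize ha0, normalize_dvd_iff.2 ha⟩,
        ⟨monic_normalize hb0, normalize_dvd_iff.2 hb⟩⟩
    · simp only
      exact eq_of_monic_of_associated ((monic_normalize ha0).mul (monic_normalize hb0)) hc.1
        ((normalize_associated a).mul_mul (normalize_associated b))
  · rintro ⟨a, b⟩ _
    simp

lemma sum_D_pow (φ : E[X] →* ℤ) {p : E[X]} (hp : Irreducible p) (hm : p.Monic) (k : ℕ) :
    ∑ a ∈ D (p ^ k), φ a = ∑ i ∈ Finset.range (k+1), φ p ^ i := by
  symm
  refine Finset.sum_bij (fun i _ => p ^ i) ?_ ?_ ?_ ?_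
  · intro i hi
    rw [mem_D (pow_ne_zero _ hp.ne_zero)]
    exact ⟨hm.pow i, pow_dvd_pow _ (by simp at hi; omega)⟩
  · intro i _ j _ h
    exact pow_injective_of_not_isUnit hp.not_isUnit hp.ne_zero h
  · intro a ha
    rw [mem_D (pow_ne_zero _ hp.ne_zero)] at ha
    obtain ⟨i, hi, h⟩ := (dvd_prime_pow hp.prime k).1 ha.2
    exact ⟨i, by simp; omega, (eq_of_monic_of_associated ha.1 (hm.pow i) h).symm⟩
  · simp

lemma D_congr {g h : E[X]} (hg : g ≠ 0) (hgh : Associated g h) : D g = D h := by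
  ext a
  rw [mem_D hg, mem_D (hgh.ne_zero_iff.1 hg), hgh.dvd_iff_dvd_right]

lemma geom_nonneg {x y : ℤ} (hx : x = 0 ∨ x = 1 ∨ x = -1) (hy : x ≠ 0 → y = 1 ∨ y = -1)
    (h : x ≠ 0 → y = 1 → x = 1) (k : ℕ) :
    0 ≤ x ^ k * ∑ i ∈ Finset.range (k+1), y ^ i := by
  rcases eq_or_ne x 0 with rfl | h0
  · rcases k with _ | k <;> simp
  · rcases hy h0 with rfl | rfl
    · rw [h h0 rfl]; simp; positivity
    · rw [neg_one_geom_sum]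
      rcases Nat.even_or_odd k with hk | hk
      · rcases hx with rfl | rfl | rfl
        · simp at h0
        · split_ifs <;> simp
        · rw [hk.neg_one_pow]; split_ifs <;> simp
      · rw [if_pos (by simpa using hk.add_one)]; simp

lemma F_nonneg (ψ φ : E[X] →* ℤ) (hψ : ∀ g, ψ g = 0 ∨ ψ g = 1 ∨ ψ g = -1)
    (hψu : ∀ u, IsUnit u → ψ u = 1)
    (hφ : ∀ g, ψ g ≠ 0 → φ g = 1 ∨ φ g = -1)
    (H : ∀ p, Irreducible p → p.Monic → ψ p ≠ 0 → φ p = 1 → ψ p = 1) (g : E[X]) (hg : g ≠ 0) :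
    0 ≤ ψ g * ∑ a ∈ D g, φ a := by
  classical
  have hass : ∀ {x y}, Associated x y → ψ x = ψ y := by
    rintro x y ⟨u, rfl⟩
    simp [hψu _ u.isUnit]
  revert hg
  induction g using UniqueFactorizationMonoid.induction_on_coprime with
  | h0 => simp
  | @h1 x hu =>
    intro h0
    have : D x = {1} := by
      ext a
      rw [mem_D h0]
      simp only [Finset.mem_singleton]
      constructor
      · rintro ⟨h1, h2⟩
        exact h1.eq_one_of_isUnit (isUnit_of_dvd_unit h2 hu)
      · rintro rfl; exact ⟨monic_one, one_dvd _⟩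
    rw [this, hψu x hu]
    simp
  | @hpr p k hp =>
    intro h0
    have hass' : Associated p (normalize p) := (normalize_associated p).symm
    rw [D_congr h0 (hass'.pow_pow), hass (hass'.pow_pow (n := k))]
    have hi : Irreducible (normalize p) := hass'.irreducible hp.irreducible
    have hm := monic_normalize hp.ne_zero
    rw [sum_D_pow φ hi hm, map_pow]
    exact geom_nonneg (hψ _) (hφ _) (H _ hi hm) k
  | @hcp x y hxy hx hy =>
    intro h0
    have hx0 := left_ne_zero_of_mul h0
    have hy0 := right_ne_zero_of_mul h0
    rw [sum_D_mul φ hx0 hy0 hxy.isCoprime, map_mul]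
    have := mul_nonneg (hx hx0) (hy hy0)
    calc _ ≤ _ := this
      _ = _ := by ring

end SqRefl

namespace SqRefl

/-- det of polynomial in a matrix is a resultant -/
lemma det_aeval {E : Type*} [Field E] {ι : Type*} [Fintype ι] [DecidableEq ι]
    (A : Matrix ι ι E) (g : E[X]) :
    (aeval A g).det = resultant A.charpoly g A.charpoly.natDegree g.natDegree := by
  let K := AlgebraicClosure E
  apply (algebraMap E K).injective
  rw [← resultant_map_map, RingHom.map_det]
  have h1 : (algebraMap E K).mapMatrix (aeval A g) =
      aeval ((algebraMap E K).mapMatrix A) (g.map (algebraMap E K)) := by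
    simp only [aeval_def, eval₂_eq_sum_range, map_sum, natDegree_map]
    refine Finset.sum_congr rfl fun i _ => ?_
    rw [map_mul, map_pow, coeff_map]
    congr 1
    ext i j
    by_cases hij : i = j <;> simp [Matrix.algebraMap_matrix_apply, hij]
  rw [h1, ← Matrix.charpoly_map]
  set B := A.map (algebraMap E K)
  have hB : (algebraMap E K).mapMatrix A = B := rfl
  have hdg : g.natDegree = (g.map (algebraMap E K)).natDegree := (natDegree_map _).symm
  have hdA : A.charpoly.natDegree = B.charpoly.natDegree := by
    simp [Matrix.charpoly_natDegree_eq_dim]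
  rw [hB, hdg, hdA]
  generalize g.map (algebraMap E K) = g'
  rw [resultant_comm, resultant_eq_prod_eval _ _ _ le_rfl (IsAlgClosed.splits g')]
  have hs := (IsAlgClosed.splits g').eq_prod_roots
  have hc := (IsAlgClosed.splits g').natDegree_eq_card_roots
  have hdet : ∀ s : Multiset K, (aeval B (s.map fun a => X - C a).prod).det =
      (-1) ^ (B.charpoly.natDegree * s.card) * (s.map fun a => B.charpoly.eval a).prod := by
    intro s
    induction s using Multiset.induction_on with
    | empty => simp
    | cons a s ih =>
      simp only [Multiset.map_cons, Multiset.prod_cons, map_mul, Matrix.det_mul, ih,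
        Multiset.card_cons, Matrix.eval_charpoly, Matrix.charpoly_natDegree_eq_dim]
      have : (aeval B) (X - C a) = - (Matrix.scalar ι a - B) := by
        simp [Matrix.scalar_apply, Matrix.algebraMap_eq_diagonal]
      rw [this, Matrix.det_neg]
      ring
  conv_lhs => rw [hs]
  rw [map_mul, Matrix.det_mul, hdet, ← hc, aeval_C, Matrix.algebraMap_eq_diagonal, Matrix.det_diagonal]
  simp [Matrix.charpoly_natDegree_eq_dim]
  ring

lemma norm_eq_resultant {E : Type*} [Field E] {f : E[X]} (hf : f ≠ 0) (g : E[X]) :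
    f.leadingCoeff ^ g.natDegree * Algebra.norm E (Ideal.Quotient.mk (Ideal.span {f}) g) =
      resultant f g := by
  let pb := AdjoinRoot.powerBasis hf
  have h1 : (Ideal.Quotient.mk (Ideal.span {f}) g) = aeval pb.gen g := by
    simp [pb]; rfl
  have h2 : Algebra.norm E (Ideal.Quotient.mk (Ideal.span {f}) g) = 
    (aeval (Algebra.leftMulMatrix pb.basis pb.gen) g).det := by
    rw [h1, aeval_algHom_apply]
    exact Algebra.norm_eq_matrix_det pb.basis _
  rw [h2, det_aeval, charpoly_leftMulMatrix]
  have h3 : minpoly E pb.gen = f * C f.leadingCoeff⁻¹ := AdjoinRoot.minpoly_root hf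
  rw [h3, mul_comm f, resultant_C_mul_left, natDegree_C_mul (by simpa using hf),
    ← mul_assoc, ← mul_pow, mul_inv_cancel₀ (by simpa using hf), one_pow, one_mul]

lemma recip {E : Type*} [Field E] {f : E[X]} (hf : f ≠ 0) {P : E[X]} (hP : P.Monic) :
    Algebra.norm E (Ideal.Quotient.mk (Ideal.span {P}) f) = 
    ((-1) ^ f.natDegree * f.leadingCoeff) ^ P.natDegree *
      Algebra.norm E (Ideal.Quotient.mk (Ideal.span {f}) P) := by
  have h1 := norm_eq_resultant hf P
  have h2 := norm_eq_resultant hP.ne_zero f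
  rw [resultant_comm, ← h1, hP.leadingCoeff, one_pow, one_mul] at h2
  rw [h2, mul_pow, ← pow_mul, mul_assoc, mul_comm P.natDegree]

lemma isSquare_of_norm {E : Type*} [Field E] [Fintype E] [DecidableEq E] (hcard : Odd (Fintype.card E))
    {P : E[X]} (hP : Irreducible P) (f : E[X])
    (h : quadraticChar E (Algebra.norm E (Ideal.Quotient.mk (Ideal.span {P}) f)) = 1) :
    ∃ h, P ∣ h ^ 2 - f := by
  have : Fact (Irreducible P) := ⟨hP⟩
  let L := AdjoinRoot P
  have : Module.Finite E L := (AdjoinRoot.powerBasis hP.ne_zero).finite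
  have : Finite L := Module.finite_of_finite E
  let := Fintype.ofFinite L
  let x : L := AdjoinRoot.mk P f
  have hx : quadraticChar E (Algebra.norm E x) = 1 := h
  have h2 : ringChar E ≠ 2 := fun h => by
    have := FiniteField.even_card_of_char_two h
    rw [Nat.odd_iff] at hcard; omega
  have hn0 : Algebra.norm E x ≠ 0 := by intro h; rw [h] at hx; simp at hx
  have hx0 : x ≠ 0 := by intro h; apply hn0; rw [h]; simp
  have hL2 : ringChar L ≠ 2 := by
    rwa [← Algebra.ringChar_eq E L]
  have hpow : (Algebra.norm E x) ^ (Fintype.card E / 2) = 1 := by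
    have := quadraticChar_eq_pow_of_char_ne_two' h2 (Algebra.norm E x)
    rw [hx] at this; simpa using this.symm
  have hsq : IsSquare x := by
    rw [FiniteField.isSquare_iff hL2 hx0]
    have hN := FiniteField.algebraMap_norm_eq_pow (K := E) (x := x)
    apply_fun algebraMap E L at hpow
    rw [map_pow, hN, map_one, ← pow_mul] at hpow
    rw [← hpow]
    congr 1
    simp only [Nat.card_eq_fintype_card]
    have hc : Fintype.card L = Fintype.card E ^ Module.finrank E L := Module.card_eq_pow_finrank
    obtain ⟨k, hk⟩ := hcard
    obtain ⟨m, hm⟩ : Fintype.card E - 1 ∣ Fintype.card L - 1 := by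
      rw [hc]; simpa using Nat.sub_dvd_pow_sub_pow (Fintype.card E) 1 (Module.finrank E L)
    have hk0 : 0 < k := by
      have := Fintype.one_lt_card (α := E); omega
    have hLpos := Fintype.one_lt_card (α := L)
    have e1 : Fintype.card E - 1 = 2 * k := by omega
    have e2 : Fintype.card E / 2 = k := by omega
    rw [e1] at hm ⊢
    rw [hm, e2, Nat.mul_div_cancel_left _ (by omega)]
    rw [mul_assoc] at hm
    rw [mul_comm m k]
    omega
  obtain ⟨y, hy⟩ := hsq
  obtain ⟨h, rfl⟩ := AdjoinRoot.mk_surjective y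
  refine ⟨h, ?_⟩
  rw [← AdjoinRoot.mk_eq_zero, map_sub, map_pow, pow_two, ← hy, sub_self]
end SqRefl

namespace SqRefl
variable {E : Type*} [Field E] [Fintype E]

lemma sum_M_eq {f : E[X]} (hf : f ≠ 0) [Fintype (E[X] ⧸ Ideal.span {f})]
    (θ : E[X] ⧸ Ideal.span {f} → ℤ) {n : ℕ} (hn : f.natDegree ≤ n) :
    (Fintype.card (E[X] ⧸ Ideal.span {f}) : ℤ) *
      ∑ g ∈ M E n, θ (Ideal.Quotient.mk (Ideal.span {f}) g) =
    (Fintype.card E : ℤ) ^ n * ∑ x, θ x := by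
  classical
  have : Finite (degreeLT E n) := Module.finite_of_finite E
  let := Fintype.ofFinite (degreeLT E n)
  let π := Ideal.Quotient.mk (Ideal.span {f})
  let L : degreeLT E n →+ E[X] ⧸ Ideal.span {f} :=
    π.toAddMonoidHom.comp (degreeLT E n).subtype.toAddMonoidHom
  have hL : Function.Surjective L := by
    intro x
    obtain ⟨p, rfl⟩ := Ideal.Quotient.mk_surjective x
    refine ⟨⟨p % f, ?_⟩, ?_⟩
    · rw [mem_degreeLT]
      refine (EuclideanDomain.mod_lt p hf).trans_le ?_
      rw [degree_eq_natDegree hf]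
      exact_mod_cast hn
    · change π (p % f) = π p
      rw [Ideal.Quotient.eq, Ideal.mem_span_singleton]
      rw [EuclideanDomain.mod_eq_sub_mul_div]
      exact ⟨-(p / f), by ring⟩
  have hfib : ∀ x, (Finset.univ.filter fun p => L p = x).card =
      (Finset.univ.filter fun p => L p = 0).card := fun x =>
    AddMonoidHom.card_fiber_eq_of_mem_range L (hL x) (hL 0)
  set K := (Finset.univ.filter fun p => L p = 0).card
  have hsum : ∀ η : E[X] ⧸ Ideal.span {f} → ℤ, ∑ p, η (L p) = K * ∑ x, η x := by
    intro η
    rw [← Finset.sum_fiberwise Finset.univ L, Finset.mul_sum]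
    refine Finset.sum_congr rfl fun x _ => ?_
    rw [Finset.sum_congr rfl (g := fun _ => η x) (by intro p hp; simp at hp; rw [hp]),
      Finset.sum_const, hfib]
    simp
  have hK : (K : ℤ) * Fintype.card (E[X] ⧸ Ideal.span {f}) = (Fintype.card E : ℤ) ^ n := by
    have := hsum (fun _ => 1)
    simp at this
    rw [← this, ← Nat.card_eq_fintype_card, Nat.card_congr (degreeLTEquiv E n).toEquiv]
    simp
  have hM : ∑ g ∈ M E n, θ (π g) = ∑ p, θ (π (X ^ n) + L p) := by
    symm
    refine Finset.sum_bij (fun p _ => X ^ n + (p : E[X])) ?_ ?_ ?_ ?_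
    · rintro ⟨p, hp⟩ _
      rw [mem_degreeLT] at hp
      rw [mem_M]
      refine ⟨monic_X_pow_add hp, ?_⟩
      rw [natDegree_add_eq_left_of_degree_lt (by simpa using hp), natDegree_X_pow]
    · intro p _ q _ h
      exact Subtype.ext (add_left_cancel h)
    · intro g hg
      rw [mem_M] at hg
      refine ⟨⟨g - X ^ n, ?_⟩, Finset.mem_univ _, by simp⟩
      rw [mem_degreeLT]
      have : g.degree = n := by rw [degree_eq_natDegree hg.1.ne_zero, hg.2]
      rw [← this]
      exact degree_sub_lt_left (by simp [this]) hg.1.ne_zero (by simp [hg.1.leadingCoeff])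
    · intro p _
      simp [L, π]
  change _ * ∑ g ∈ M E n, θ (π g) = _
  rw [hM, hsum (fun x => θ (π (X ^ n) + x)), ← hK, ← mul_assoc]
  congr 1
  · ring
  · exact Equiv.sum_comp (Equiv.addLeft (π (X ^ n))) θ

lemma crt {f : E[X]} (s : Finset E[X])
    (hs : ∀ p ∈ s, p.Monic ∧ Irreducible p ∧ ∃ h, p ∣ h ^ 2 - f) :
    ∃ h, (∏ p ∈ s, p) ∣ h ^ 2 - f := by
  classical
  induction s using Finset.induction_on with
  | empty => exact ⟨0, by simp⟩
  | insert p s hp ih =>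
    obtain ⟨h1, hh1⟩ := ih fun q hq => hs q (Finset.mem_insert_of_mem hq)
    obtain ⟨hm, hi, h2, hh2⟩ := hs p (Finset.mem_insert_self _ _)
    have hc : IsCoprime p (∏ q ∈ s, q) := by
      refine IsCoprime.prod_right fun q hq => ?_
      refine (hi.coprime_iff_not_dvd).2 fun hd => hp ?_
      obtain ⟨hqm, hqi, -⟩ := hs q (Finset.mem_insert_of_mem hq)
      rw [eq_of_monic_of_associated hm hqm (hi.associated_of_dvd hqi hd)]
      exact hq
    rw [Finset.prod_insert hp]
    obtain ⟨a, b, hab⟩ := id hc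
    set Q := ∏ q ∈ s, q
    refine ⟨h1 * (a * p) + h2 * (b * Q), hc.mul_dvd ?_ ?_⟩
    · obtain ⟨k, hk⟩ := hh2
      have : b * Q = 1 - a * p := by rw [← hab]; ring
      rw [this]
      have : (h1 * (a * p) + h2 * (1 - a * p)) ^ 2 - f = (h2 ^ 2 - f) +
        p * (a * (h1 - h2)) * (2 * h2 + (h1 - h2) * (a * p)) := by ring
      rw [this, hk]
      exact ⟨k + (a * (h1 - h2)) * (2 * h2 + (h1 - h2) * (a * p)), by ring⟩
    · obtain ⟨k, hk⟩ := hh1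
      have : a * p = 1 - b * Q := by rw [← hab]; ring
      rw [this]
      have : (h1 * (1 - b * Q) + h2 * (b * Q)) ^ 2 - f = (h1 ^ 2 - f) +
        Q * (b * (h2 - h1)) * (2 * h1 + (h2 - h1) * (b * Q)) := by ring
      rw [this, hk]
      exact ⟨k + (b * (h2 - h1)) * (2 * h1 + (h2 - h1) * (b * Q)), by ring⟩

/-- admissible finite sets of primes -/
def Adm (f : E[X]) (s : Finset E[X]) : Prop :=
  ∀ p ∈ s, p.Monic ∧ Irreducible p ∧ IsCoprime f p ∧ ∃ h, p ∣ h ^ 2 - f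

lemma isUnit_mk {f g : E[X]} : IsUnit (Ideal.Quotient.mk (Ideal.span {f}) g) ↔ IsCoprime f g := by
  rw [isUnit_iff_exists_inv]
  constructor
  · rintro ⟨b, hb⟩
    obtain ⟨b, rfl⟩ := Ideal.Quotient.mk_surjective b
    rw [← map_mul, ← map_one (Ideal.Quotient.mk (Ideal.span {f})), Ideal.Quotient.eq,
      Ideal.mem_span_singleton] at hb
    obtain ⟨k, hk⟩ := hb
    exact ⟨-k, b, by linear_combination hk⟩
  · rintro ⟨a, b, h⟩
    refine ⟨Ideal.Quotient.mk _ b, ?_⟩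
    rw [← map_mul, ← map_one (Ideal.Quotient.mk (Ideal.span {f})), Ideal.Quotient.eq,
      Ideal.mem_span_singleton]
    exact ⟨-a, by linear_combination h⟩

/-- The subgroup of good classes. -/
def H (f : E[X]) : Subgroup (E[X] ⧸ Ideal.span {f})ˣ where
  carrier := {u | ∃ (c : E) (s : Finset E[X]) (β : (E[X] ⧸ Ideal.span {f})ˣ), c ≠ 0 ∧ Adm f s ∧
    Ideal.Quotient.mk (Ideal.span {f}) (C c * ∏ p ∈ s, p) = (u : E[X] ⧸ Ideal.span {f}) * β ^ 2}
  one_mem' := ⟨1, ∅, 1, one_ne_zero, by simp [Adm], by simp⟩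
  mul_mem' := by
    classical
    rintro u v ⟨c, s, β, hc, hs, h⟩ ⟨c', s', β', hc', hs', h'⟩
    have hu : IsUnit (Ideal.Quotient.mk (Ideal.span {f}) (∏ p ∈ s ∩ s', p)) :=
      isUnit_mk.2 (IsCoprime.prod_right fun p hp => (hs p (Finset.mem_inter.1 hp).1).2.2.1)
    obtain ⟨w, hw⟩ := hu
    refine ⟨c * c', symmDiff s s', β * β' * w⁻¹, mul_ne_zero hc hc', ?_, ?_⟩
    · intro p hp
      rcases Finset.mem_symmDiff.1 hp with hp | hp
      · exact hs p hp.1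
      · exact hs' p hp.1
    · have e : (∏ p ∈ s, p) * (∏ p ∈ s', p) = (∏ p ∈ symmDiff s s', p) * (∏ p ∈ s ∩ s', p) ^ 2 := by
        have hun : s ∪ s' = symmDiff s s' ∪ (s ∩ s') := by
          ext x; simp only [Finset.mem_union, Finset.mem_inter, Finset.mem_symmDiff]; tauto
        rw [← Finset.prod_union_inter, hun, Finset.prod_union]
        · ring
        · rw [Finset.disjoint_left]
          intro x hx hx'
          rw [Finset.mem_symmDiff] at hx
          rw [Finset.mem_inter] at hx'
          tauto
      have e2 := congrArg (Ideal.Quotient.mk (Ideal.span {f})) e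
      simp only [map_mul, map_pow, ← hw] at e2 h h' ⊢
      simp only [Units.val_mul]
      have hw1 : (w : E[X] ⧸ Ideal.span {f}) * (w⁻¹ : (E[X] ⧸ Ideal.span {f})ˣ) = 1 := by simp
      set wi := ((w⁻¹ : (E[X] ⧸ Ideal.span {f})ˣ) : E[X] ⧸ Ideal.span {f})
      set S := (Ideal.Quotient.mk (Ideal.span {f})) (∏ p ∈ symmDiff s s', p)
      have e3 : S = (Ideal.Quotient.mk (Ideal.span {f})) (∏ p ∈ s, p) *
          (Ideal.Quotient.mk (Ideal.span {f})) (∏ p ∈ s', p) * wi ^ 2 := by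
        rw [e2, mul_assoc, ← mul_pow, hw1]; simp
      rw [e3]
      linear_combination (Ideal.Quotient.mk (Ideal.span {f})) (C c') * wi ^ 2 * (Ideal.Quotient.mk (Ideal.span {f})) (∏ p ∈ s', p) * h + u * β ^ 2 * wi ^ 2 * h'
  inv_mem' := by
    rintro u ⟨c, s, β, hc, hs, h⟩
    refine ⟨c, s, u * β, hc, hs, ?_⟩
    rw [h]
    simp only [Units.val_mul]
    have : ((u⁻¹ : (E[X] ⧸ Ideal.span {f})ˣ) : E[X] ⧸ Ideal.span {f}) * u = 1 := by simp
    linear_combination - u * β^2 * this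


lemma const_mem_H {f : E[X]} {c : E} (hc : c ≠ 0) (u : (E[X] ⧸ Ideal.span {f})ˣ)
    (hu : (u : E[X] ⧸ Ideal.span {f}) = Ideal.Quotient.mk _ (C c)) : u ∈ H f :=
  ⟨c, ∅, 1, hc, by simp [Adm], by simp [hu]⟩

lemma sq_mem_H {f : E[X]} (u : (E[X] ⧸ Ideal.span {f})ˣ) : u ^ 2 ∈ H f :=
  ⟨1, ∅, u⁻¹, one_ne_zero, by simp [Adm], by
    rw [← Units.val_pow_eq_pow_val, ← Units.val_mul, inv_pow, mul_inv_cancel]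
    simp⟩

lemma exists_char_aux {G : Type*} [CommGroup G] [Finite G] (K : Subgroup G)
    (hK : ∀ u : G, u ^ 2 ∈ K) (α : G) (hα : α ∉ K) :
    ∃ ρ : G →* ℤˣ, ρ α ≠ 1 ∧ ∀ u ∈ K, ρ u = 1 := by
  have h2 : HasEnoughRootsOfUnity ℤ 2 :=
    { prim := ⟨-1, IsPrimitiveRoot.neg_one 0 (by norm_num)⟩
      cyc := inferInstance }
  have hexp : Monoid.exponent (G ⧸ K) ∣ 2 := by
    apply Monoid.exponent_dvd_of_forall_pow_eq_one
    intro g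
    obtain ⟨u, rfl⟩ := QuotientGroup.mk_surjective g
    rw [← QuotientGroup.mk_pow, QuotientGroup.eq_one_iff]
    exact hK u
  have := HasEnoughRootsOfUnity.of_dvd ℤ hexp
  obtain ⟨ρ, hρ⟩ := CommGroup.exists_apply_ne_one_of_hasEnoughRootsOfUnity
    (G ⧸ K) ℤ (a := (α : G ⧸ K)) (by rwa [Ne, QuotientGroup.eq_one_iff])
  refine ⟨ρ.comp (QuotientGroup.mk' _), hρ, fun u hu => ?_⟩
  have : (QuotientGroup.mk' K) u = 1 := (QuotientGroup.eq_one_iff u).2 hu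
  rw [MonoidHom.comp_apply, this, map_one]

lemma exists_char {f : E[X]} [Finite (E[X] ⧸ Ideal.span {f})] (α : (E[X] ⧸ Ideal.span {f})ˣ)
    (hα : α ∉ H f) : ∃ ρ : (E[X] ⧸ Ideal.span {f})ˣ →* ℤˣ, ρ α ≠ 1 ∧ ∀ u ∈ H f, ρ u = 1 :=
  exists_char_aux (H f) sq_mem_H α hα

/-- The numerical contradiction. -/
lemma growth (A B : ℕ → ℤ) (F : ℕ → ℤ) (d k : ℕ) (Q q ε S : ℤ) (hQ : 0 < Q) (hq : 0 < q)
    (hk : 1 ≤ k)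
    (hε : ε = 1 ∨ ε = -1)
    (hF : ∀ n, F n = ∑ i ∈ Finset.range (n+1), A i * B (n - i))
    (hA : ∀ i, d ≤ i → A i = 0) (hB : ∀ j, d ≤ j → Q * B j = (ε * q) ^ j * S)
    (h0 : ∀ n, 0 ≤ F n) (hpos : ∀ m, 0 < F (k * (2 * m))) (hS : ε = 1 → S = 0) : False := by
  have hF' : ∀ n, 2 * d ≤ n → Q * F n = (∑ i ∈ Finset.range d, A i * (ε * q) ^ (n - i)) * S := by
    intro n hn
    rw [hF, ← Finset.sum_subset (Finset.range_mono (show d ≤ n + 1 by omega)), Finset.mul_sum,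
      Finset.sum_mul]
    · refine Finset.sum_congr rfl fun i hi => ?_
      rw [Finset.mem_range] at hi
      rw [mul_left_comm, hB _ (by omega)]; ring
    · intro i _ hi
      rw [hA i (by simpa using hi), zero_mul]
  have hn : 2 * d ≤ k * (2 * d) := by nlinarith
  have hp := hpos d
  generalize k * (2 * d) = n at hn hp
  rcases hε with h | h
  · have := hF' n hn
    rw [hS h, mul_zero] at this
    have := mul_pos hQ hp
    omega
  · have h1 := hF' n hn
    have h2 := hF' (n + 1) (by omega)
    have h3 : ∑ i ∈ Finset.range d, A i * (ε * q) ^ (n + 1 - i) =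
        (ε * q) * ∑ i ∈ Finset.range d, A i * (ε * q) ^ (n - i) := by
      rw [Finset.mul_sum]
      refine Finset.sum_congr rfl fun i hi => ?_
      rw [Finset.mem_range] at hi
      rw [show n + 1 - i = (n - i) + 1 by omega, pow_succ]; ring
    rw [h3, mul_assoc, ← h1, h] at h2
    have := mul_pos hq (mul_pos hQ hp)
    have := mul_nonneg hQ.le (h0 (n+1))
    linarith

lemma exists_prime {f : E[X]} (hf : 0 < f.natDegree) :
    ∃ P : E[X], P.Monic ∧ Irreducible P ∧ IsCoprime f P := by
  classical
  have hf0 : f ≠ 0 := by rintro rfl; simp at hf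
  have hd : (X * f + 1).natDegree = f.natDegree + 1 := by
    rw [← C_1, natDegree_add_C, natDegree_X_mul hf0]
  have hu : ¬ IsUnit (X * f + 1) := fun h => by
    have := natDegree_eq_zero_of_isUnit h
    omega
  obtain ⟨p, hp, hpd⟩ := WfDvdMonoid.exists_irreducible_factor hu
    (by intro h; rw [h] at hd; simp at hd)
  have hass : Associated (normalize p) p := normalize_associated p
  refine ⟨normalize p, monic_normalize hp.ne_zero, hass.symm.irreducible hp, ?_⟩
  obtain ⟨k, hk⟩ := hass.dvd.trans hpd
  exact ⟨-X, k, by linear_combination -hk⟩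

theorem main (hcard : Odd (Fintype.card E)) {f : E[X]} (hf : 0 < f.natDegree)
    (α : (E[X] ⧸ Ideal.span {f})ˣ)
    (hα : ∃ u : Eˣ, Algebra.norm E (α : E[X] ⧸ Ideal.span {f}) = (u : E) ^ 2 ∨
      Algebra.norm E (α : E[X] ⧸ Ideal.span {f}) = f.leadingCoeff * (u : E) ^ 2) : α ∈ H f := by
  classical
  by_contra hαH
  have hf0 : f ≠ 0 := by rintro rfl; simp at hf
  have hfin : Module.Finite E (E[X] ⧸ Ideal.span {f}) := (AdjoinRoot.powerBasis hf0).finite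
  have hrank : Module.finrank E (E[X] ⧸ Ideal.span {f}) = f.natDegree :=
    (AdjoinRoot.powerBasis hf0).finrank
  have : Finite (E[X] ⧸ Ideal.span {f}) := Module.finite_of_finite E
  have := Fintype.ofFinite (E[X] ⧸ Ideal.span {f})
  have hnt : Nontrivial (E[X] ⧸ Ideal.span {f}) := by
    apply Module.nontrivial_of_finrank_pos (R := E); rw [hrank]; exact hf
  obtain ⟨ρ, hρα, hρH⟩ := exists_char α hαH
  let π := Ideal.Quotient.mk (Ideal.span {f})
  let χ := quadraticChar E
  let ψ : MulChar (E[X] ⧸ Ideal.span {f}) ℤ := MulChar.ofUnitHom ρ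
  let νu : (E[X] ⧸ Ideal.span {f})ˣ →* ℤˣ := Units.map (χ.toMonoidHom.comp (Algebra.norm E))
  let ν : MulChar (E[X] ⧸ Ideal.span {f}) ℤ := MulChar.ofUnitHom νu
  have hψu : ∀ u : (E[X] ⧸ Ideal.span {f})ˣ, ψ u = ρ u := fun u => MulChar.ofUnitHom_coe ρ u
  have hνu : ∀ u : (E[X] ⧸ Ideal.span {f})ˣ, ν u = χ (Algebra.norm E (u : E[X] ⧸ Ideal.span {f})) :=
    fun u => MulChar.ofUnitHom_coe νu u
  have hν1 : ∀ u : (E[X] ⧸ Ideal.span {f})ˣ, ν u = 1 ∨ ν u = -1 := fun u =>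
    Int.isUnit_iff.1 (u.isUnit.map ν)
  have hψ1 : ∀ u : (E[X] ⧸ Ideal.span {f})ˣ, ψ u = 1 ∨ ψ u = -1 := fun u =>
    Int.isUnit_iff.1 (u.isUnit.map ψ)
  let c := f.leadingCoeff
  have hc : c ≠ 0 := leadingCoeff_ne_zero.2 hf0
  let ε : ℤ := χ ((-1) ^ f.natDegree * c)
  have hε : ε = 1 ∨ ε = -1 := by
    apply Int.isUnit_iff.1
    exact (IsUnit.mk0 _ (mul_ne_zero (by simp) hc)).map χ
  have hcoe : ∀ (g : E[X]), ψ (π g) ≠ 0 → ∃ u : (E[X] ⧸ Ideal.span {f})ˣ, (u : E[X] ⧸ Ideal.span {f}) = π g := by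
    intro g hg
    by_contra hn
    exact hg (ψ.map_nonunit hn)
  let ψ' : E[X] →* ℤ := ψ.toMonoidHom.comp π.toMonoidHom
  have hψ' : ∀ g, ψ' g = ψ (π g) := fun _ => rfl
  let φ : E[X] →* ℤ :=
    { toFun := fun g => ε ^ g.natDegree * ν (π g)
      map_one' := by simp
      map_mul' := by
        intro x y
        rcases eq_or_ne x 0 with rfl | hx
        · simp [MulChar.map_zero]
        rcases eq_or_ne y 0 with rfl | hy
        · simp [MulChar.map_zero]
        rw [natDegree_mul hx hy, map_mul, map_mul, pow_add]; ring }
  have hφ' : ∀ g, φ g = ε ^ g.natDegree * ν (π g) := fun _ => rfl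
  have hφ1 : ∀ g, ψ' g ≠ 0 → φ g = 1 ∨ φ g = -1 := by
    intro g hg
    obtain ⟨u, hu⟩ := hcoe g hg
    apply Int.isUnit_iff.1
    rw [hφ', ← hu]
    exact ((Int.isUnit_iff.2 hε).pow _).mul (Int.isUnit_iff.2 (hν1 u))
  have hψ'1 : ∀ g, ψ' g = 0 ∨ ψ' g = 1 ∨ ψ' g = -1 := by
    intro g
    by_cases hg : ψ' g = 0
    · exact Or.inl hg
    · obtain ⟨u, hu⟩ := hcoe g hg
      right; rw [hψ', ← hu]; exact hψ1 u
  have hψconst : ∀ u, IsUnit u → ψ' u = 1 := by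
    intro g hg
    obtain ⟨l, hl, rfl⟩ := Polynomial.isUnit_iff.1 hg
    obtain ⟨u, hu⟩ := hg.map π
    rw [hψ', ← hu, hψu, hρH u (const_mem_H hl.ne_zero u hu)]; rfl
  have hprime : ∀ p, Irreducible p → p.Monic → ψ' p ≠ 0 → φ p = 1 → ψ' p = 1 := by
    intro p hp hm h0 h1
    obtain ⟨u, hu⟩ := hcoe p h0
    have hsq : ∃ h, p ∣ h ^ 2 - f := by
      apply isSquare_of_norm hcard hp
      rw [recip hf0 hm, map_mul, map_pow, ← h1, hφ', ← hu, hνu, hu]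
    have hmem : u ∈ H f := ⟨1, {p}, 1, one_ne_zero, by
      intro q hq
      rw [Finset.mem_singleton] at hq
      subst hq
      refine ⟨hm, hp, isUnit_mk.1 ⟨u, hu⟩, hsq⟩, by simp [hu, π]⟩
    rw [hψ', ← hu, hψu, hρH u hmem]; rfl
  obtain ⟨P, hPm, hPi, hPc⟩ := exists_prime hf
  have hFnn : ∀ g : E[X], g ≠ 0 → 0 ≤ ψ' g * ∑ a ∈ D g, φ a :=
    fun g hg => F_nonneg ψ' φ hψ'1 hψconst hφ1 hprime g hg
  have hψne : ψ ≠ 1 := by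
    intro h
    have h1 := hψu α
    rw [h, MulChar.one_apply_coe] at h1
    exact hρα (Units.ext h1.symm)
  have hQ : (0 : ℤ) < Fintype.card (E[X] ⧸ Ideal.span {f}) := by exact_mod_cast Fintype.card_pos
  refine growth (fun i => ∑ b ∈ M E i, ψ' b) (fun j => ∑ a ∈ M E j, ψ' a * φ a)
    (fun n => ∑ g ∈ M E n, ψ' g * ∑ a ∈ D g, φ a) f.natDegree P.natDegree
    (Fintype.card (E[X] ⧸ Ideal.span {f})) (Fintype.card E) ε (∑ x, (ψ * ν) x) hQ
    (by exact_mod_cast Fintype.card_pos) hPi.natDegree_pos hε (fun n => conv ψ' φ n) ?_ ?_ ?_ ?_ ?_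
  · intro i hi
    have := sum_M_eq hf0 (fun x => ψ x) hi
    rw [MulChar.sum_eq_zero_of_ne_one hψne, mul_zero] at this
    exact (mul_eq_zero.1 this).resolve_left hQ.ne'
  · intro j hj
    have h1 := sum_M_eq hf0 (fun x => (ψ * ν) x) hj
    have h2 : ∑ a ∈ M E j, ψ' a * φ a = ε ^ j * ∑ g ∈ M E j, (ψ * ν) (π g) := by
      rw [Finset.mul_sum]
      refine Finset.sum_congr rfl fun g hg => ?_
      rw [mem_M] at hg
      rw [hφ', hg.2, hψ', MulChar.mul_apply]; ring
    rw [h2, mul_left_comm, h1]; ring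
  · intro n
    exact Finset.sum_nonneg fun g hg => hFnn g (mem_M.1 hg).1.ne_zero
  · intro m
    refine Finset.sum_pos' (fun g hg => hFnn g (mem_M.1 hg).1.ne_zero) ⟨P ^ (2 * m), ?_, ?_⟩
    · rw [mem_M]; exact ⟨hPm.pow _, by rw [hPm.natDegree_pow, mul_comm]⟩
    · rw [sum_D_pow φ hPi hPm, map_pow]
      have hP0 : ψ' P ≠ 0 := by
        obtain ⟨u, hu⟩ := isUnit_mk.2 hPc
        rw [hψ']
        change ψ (Ideal.Quotient.mk _ P) ≠ 0
        rw [← hu]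
        rcases hψ1 u with h | h <;> rw [h] <;> norm_num
      have h1 : ψ' P ^ (2 * m) = 1 := by
        rw [pow_mul]
        rcases (hψ'1 P).resolve_left hP0 with h | h <;> rw [h] <;> simp
      rw [h1, one_mul]
      rcases hφ1 P hP0 with h | h <;> rw [h]
      · simp
      · rw [neg_one_geom_sum, if_neg (by simp)]; norm_num
  · intro hε1
    apply MulChar.sum_eq_zero_of_ne_one
    intro hone
    have heq : ∀ u : (E[X] ⧸ Ideal.span {f})ˣ, ψ u = ν u := by
      intro u
      have : ψ u * ν u = 1 := by
        rw [← MulChar.mul_apply, hone, MulChar.one_apply_coe]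
      rcases hψ1 u with h | h <;> rcases hν1 u with h' | h' <;> rw [h, h'] at this ⊢ <;>
        norm_num at this
    have hαν : χ (Algebra.norm E (α : E[X] ⧸ Ideal.span {f})) ≠ 1 := by
      rw [← hνu, ← heq, hψu]
      exact fun h => hρα (Units.ext h)
    have hsq : ∀ u : Eˣ, χ ((u : E) ^ 2) = 1 := fun u => quadraticChar_sq_one' u.ne_zero
    obtain ⟨u, hu | hu⟩ := hα
    · exact hαν (by rw [hu, hsq])
    · rw [hu, map_mul, hsq, mul_one] at hαν
      have hcm : χ c = -1 := (Int.isUnit_iff.1 ((IsUnit.mk0 c hc).map χ)).resolve_left hαν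
      rcases Nat.even_or_odd f.natDegree with he | ho
      · have : ε = χ c := by simp only [ε]; rw [he.neg_one_pow, one_mul]
        rw [this, hcm] at hε1
        norm_num at hε1
      · have hCu : IsUnit (C c) := Polynomial.isUnit_C.2 (IsUnit.mk0 c hc)
        have h1 := hψconst _ hCu
        obtain ⟨v, hv⟩ := hCu.map π
        have hvn : Algebra.norm E (v : E[X] ⧸ Ideal.span {f}) = c ^ f.natDegree := by
          rw [hv, ← hrank]
          exact Algebra.norm_algebraMap c
        rw [hψ', ← hv, heq, hνu, hvn, map_pow, hcm, ho.neg_one_pow] at h1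
        norm_num at h1

end SqRefl

/-- Every square-free polynomial over a finite field of odd cardinality is square-reflexive. -/
theorem statement1 (E : Type*) [Field E] [Fintype E] (hcard : Odd (Fintype.card E)) :
    ∀ f : Polynomial E, Squarefree f → IsSquareReflexive f := by
  intro f hf
  refine ⟨hf, fun α hα => ?_⟩
  have hmem : α ∈ SqRefl.H f := by
    rcases Nat.eq_zero_or_pos f.natDegree with h0 | hpos
    · have hu : IsUnit f := by
        rw [eq_C_of_natDegree_eq_zero h0] at hf ⊢
        refine Polynomial.isUnit_C.2 (IsUnit.mk0 _ ?_)
        intro h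
        rw [h, C_0] at hf
        exact not_squarefree_zero hf
      have hs : Subsingleton (E[X] ⧸ Ideal.span {f}) := by
        rw [Ideal.Quotient.subsingleton_iff]
        exact Ideal.span_singleton_eq_top.2 hu
      have : α = 1 := Units.ext (Subsingleton.elim _ _)
      rw [this]; exact one_mem _
    · exact SqRefl.main hcard hpos α hα
  obtain ⟨c, s, β, hc, hs, h⟩ := hmem
  have hCu : IsUnit (C c) := Polynomial.isUnit_C.2 (IsUnit.mk0 c hc)
  refine ⟨C c * ∏ p ∈ s, p, ?_, ⟨β, h⟩, ?_⟩
  · rw [← SqRefl.isUnit_mk, h]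
    exact α.isUnit.mul (β.isUnit.pow 2)
  · obtain ⟨k, hk⟩ := SqRefl.crt (f := f) s fun p hp => ⟨(hs p hp).1, (hs p hp).2.1, (hs p hp).2.2.2⟩
    refine ⟨Ideal.Quotient.mk _ k, ?_⟩
    rw [← map_mul, eq_comm, Ideal.Quotient.eq, Ideal.mem_span_singleton, ← pow_two]
    exact (hCu.mul_left_dvd).2 hk
end

section
/- Let E be a field of characteristic different from 2 and let f ∈ E[X] be a square-free polynomial with deg f ≤ 2. Then f is square-reflexive. -/
open Polynomial

lemma sr_norm {E : Type*} [Field E] (f : Polynomial E) (c d e a b : E) (hc : c ≠ 0)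
    (hf : f = C c * X ^ 2 + C d * X + C e) :
    Algebra.norm E (AdjoinRoot.mk f (C b * X + C a)) = a ^ 2 - a * b * d / c + b ^ 2 * e / c := by
  have hn : f.natDegree = 2 := by rw [hf]; exact natDegree_quadratic hc
  have hf0 : f ≠ 0 := by rintro rfl; simp at hn
  let B := (AdjoinRoot.powerBasis hf0).basis.reindex (finCongr (show _ = 2 from hn))
  have h0 : B 0 = 1 := by simp [B]
  have h1 : B 1 = AdjoinRoot.root f := by simp [B]
  have hrel : AdjoinRoot.of f c * AdjoinRoot.root f ^ 2 + AdjoinRoot.of f d * AdjoinRoot.root f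
      + AdjoinRoot.of f e = 0 := by
    have := AdjoinRoot.mk_self (f := f)
    conv_lhs at this => rw [show AdjoinRoot.mk f f = AdjoinRoot.mk f (C c * X ^ 2 + C d * X + C e) from by rw [← hf]]
    simpa using this
  have hcc : AdjoinRoot.of f c⁻¹ * AdjoinRoot.of f c = 1 := by
    rw [← map_mul, inv_mul_cancel₀ hc, map_one]
  have e0 : AdjoinRoot.mk f (C b * X + C a) * B 0 = a • B 0 + b • B 1 := by
    rw [h0, h1, Algebra.smul_def, Algebra.smul_def, AdjoinRoot.algebraMap_eq]
    simp; ring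
  have e1 : AdjoinRoot.mk f (C b * X + C a) * B 1
      = (-(b * e * c⁻¹)) • B 0 + (a - b * d * c⁻¹) • B 1 := by
    rw [h0, h1, Algebra.smul_def, Algebra.smul_def, AdjoinRoot.algebraMap_eq]
    simp only [map_add, map_mul, map_neg, map_sub, AdjoinRoot.mk_C, AdjoinRoot.mk_X]
    linear_combination (AdjoinRoot.of f b * AdjoinRoot.of f c⁻¹) * hrel
      - (AdjoinRoot.of f b * AdjoinRoot.root f ^ 2) * hcc
  rw [Algebra.norm_eq_matrix_det B, Matrix.det_fin_two]
  simp only [Algebra.leftMulMatrix_eq_repr_mul, e0, e1]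
  simp
  field_simp

lemma sr_isCoprime {E : Type*} [Field E] (f g : Polynomial E)
    (h : IsUnit (Ideal.Quotient.mk (Ideal.span {f}) g)) : IsCoprime f g := by
  obtain ⟨v, hv⟩ := h.exists_right_inv
  obtain ⟨w, rfl⟩ := Ideal.Quotient.mk_surjective v
  rw [← map_mul, ← map_one (Ideal.Quotient.mk _), Ideal.Quotient.eq,
    Ideal.mem_span_singleton] at hv
  obtain ⟨k, hk⟩ := hv
  exact ⟨-k, w, by linear_combination hk⟩

lemma sr_const {E : Type*} [Field E] (f : Polynomial E)
    (α : (Polynomial E ⧸ Ideal.span {f})ˣ) (t : E) (ht : t ≠ 0)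
    (β : (Polynomial E ⧸ Ideal.span {f}))
    (h : Ideal.Quotient.mk (Ideal.span {f}) (C t) = α * β ^ 2) :
    ∃ g : Polynomial E, IsCoprime f g ∧
      (∃ β : (Polynomial E ⧸ Ideal.span {f})ˣ,
        Ideal.Quotient.mk (Ideal.span {f}) g
          = (α : Polynomial E ⧸ Ideal.span {f}) * (β : Polynomial E ⧸ Ideal.span {f}) ^ 2) ∧
      IsSquare (Ideal.Quotient.mk (Ideal.span {g}) f) := by
  have hu : IsUnit (C t : Polynomial E) := isUnit_C.2 ht.isUnit
  have hu' := hu.map (Ideal.Quotient.mk (Ideal.span {f}))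
  have hβ : IsUnit β := by
    rw [h] at hu'
    exact (isUnit_pow_iff two_ne_zero).1 (isUnit_of_mul_isUnit_right hu')
  refine ⟨C t, sr_isCoprime _ _ hu', ⟨hβ.unit, by simpa using h⟩, ?_⟩
  rw [Ideal.Quotient.eq_zero_iff_mem.2 (Ideal.mem_span_singleton.2 hu.dvd)]
  exact IsSquare.zero

theorem statement6 (E : Type*) [Field E] (hchar : ringChar E ≠ 2)
    (f : Polynomial E) (hf : Squarefree f) (hdeg : f.natDegree ≤ 2) :
    IsSquareReflexive f := by
  classical
  have hf0 : f ≠ 0 := hf.ne_zero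
  have h2 : (2 : E) ≠ 0 := Ring.two_ne_zero hchar
  refine ⟨hf, fun α hα => ?_⟩
  obtain ⟨p, hp⟩ := Ideal.Quotient.mk_surjective (α : Polynomial E ⧸ Ideal.span {f})
  have hq : Ideal.Quotient.mk (Ideal.span {f}) (p % f) = α := by
    rw [← hp, Ideal.Quotient.eq, Ideal.mem_span_singleton]
    exact ⟨-(p / f), by linear_combination EuclideanDomain.div_add_mod p f⟩
  have hdegq : (p % f).degree < f.degree := EuclideanDomain.mod_lt p hf0
  have hdegq2 : (p % f).natDegree ≤ 1 := by
    have := degree_le_of_natDegree_le hdeg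
    have h3 : (p % f).degree < 2 := lt_of_lt_of_le hdegq this
    by_cases h0 : p % f = 0
    · simp [h0]
    · have := (natDegree_lt_iff_degree_lt h0 (n := 2)).2 h3
      omega
  obtain ⟨b, a, hab⟩ := exists_eq_X_add_C_of_natDegree_le_one hdegq2
  rw [hab] at hq
  by_cases hsub : IsUnit f
  · have : Subsingleton (Polynomial E ⧸ Ideal.span {f}) :=
      Ideal.Quotient.subsingleton_iff.2 (Ideal.span_singleton_eq_top.2 hsub)
    exact sr_const f α 1 one_ne_zero 1 (Subsingleton.elim _ _)
  have hnt : Nontrivial (Polynomial E ⧸ Ideal.span {f}) :=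
    Ideal.Quotient.nontrivial_iff.2 (fun h => hsub (Ideal.span_singleton_eq_top.1 h))
  by_cases hb : b = 0
  · subst hb
    simp only [map_zero, zero_mul, zero_add] at hq
    refine sr_const f α a ?_ 1 (by simpa using hq)
    rintro rfl
    simp at hq
    exact α.ne_zero hq.symm
  have hn2 : f.natDegree = 2 := by
    have h1 : (p % f).natDegree = 1 := by rw [hab]; exact natDegree_linear hb
    have h0 : p % f ≠ 0 := by intro h; simp [h] at h1
    have := natDegree_lt_natDegree h0 hdegq
    omega
  have hfe : f = C (f.coeff 2) * X ^ 2 + C (f.coeff 1) * X + C (f.coeff 0) :=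
    eq_quadratic_of_degree_le_two (degree_le_of_natDegree_le hdeg)
  have hlc : f.leadingCoeff = f.coeff 2 := by rw [leadingCoeff, hn2]
  have hc : f.coeff 2 ≠ 0 := by rw [← hlc]; simpa using hf0
  generalize hcd : f.coeff 2 = c at *
  generalize f.coeff 1 = d at *
  generalize f.coeff 0 = e at *
  have hN : Algebra.norm E (α : Polynomial E ⧸ Ideal.span {f})
      = a ^ 2 - a * b * d / c + b ^ 2 * e / c := by
    rw [← hq]; exact sr_norm f c d e a b hc hfe
  rw [hN, hlc] at hα
  obtain ⟨u, hu | hu⟩ := hα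
  · -- Hilbert 90
    have key : ∀ v : E, v ^ 2 = (u : E) ^ 2 → 2 * a - b * d / c + 2 * v ≠ 0 →
        ∃ g : Polynomial E, IsCoprime f g ∧
      (∃ β : (Polynomial E ⧸ Ideal.span {f})ˣ,
        Ideal.Quotient.mk (Ideal.span {f}) g
          = (α : Polynomial E ⧸ Ideal.span {f}) * (β : Polynomial E ⧸ Ideal.span {f}) ^ 2) ∧
      IsSquare (Ideal.Quotient.mk (Ideal.span {g}) f) := by
      intro v hv ht
      refine sr_const f α _ ht
        ((α + Ideal.Quotient.mk (Ideal.span {f}) (C v)) * (↑α⁻¹ : Polynomial E ⧸ Ideal.span {f})) ?_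
      have h1 : Ideal.Quotient.mk (Ideal.span {f}) (C (2 * a - b * d / c + 2 * v)) * α
          = (α + Ideal.Quotient.mk (Ideal.span {f}) (C v)) ^ 2 := by
        rw [← hq, ← map_mul, ← map_add, ← map_pow, Ideal.Quotient.eq, Ideal.mem_span_singleton]
        refine ⟨-C (b ^ 2 / c), ?_⟩
        have h3 : v ^ 2 = a ^ 2 - a * b * d / c + b ^ 2 * e / c := by rw [hv, hu]
        have h3' : (C v : Polynomial E) ^ 2 = C a ^ 2 - C a * C b * C d * C c⁻¹
            + C b ^ 2 * C e * C c⁻¹ := by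
          simp only [← C_mul, ← C_pow, ← C_add, ← C_sub]
          rw [h3]; simp only [div_eq_mul_inv]
        have hcc : (C c : Polynomial E) * C c⁻¹ = 1 := by
          rw [← C_mul, mul_inv_cancel₀ hc, C_1]
        conv_rhs => rw [hfe]
        simp only [div_eq_mul_inv, C_mul, C_add, C_sub, C_pow, show (C (2:E)) = 2 from rfl]
        linear_combination (-1 : Polynomial E) * h3' + C b ^ 2 * X ^ 2 * hcc
      have h4 : (α : Polynomial E ⧸ Ideal.span {f}) * (↑α⁻¹ : Polynomial E ⧸ Ideal.span {f}) = 1 :=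
        α.mul_inv
      rw [mul_pow, ← h1]
      generalize Ideal.Quotient.mk (Ideal.span {f}) (C (2 * a - b * d / c + 2 * v)) = T
      generalize (↑α⁻¹ : Polynomial E ⧸ Ideal.span {f}) = A at *
      linear_combination (-T * (α * A + 1)) * h4
    by_cases ht : 2 * a - b * d / c + 2 * (u : E) = 0
    · refine key (-u) (by ring) ?_
      intro h
      have : (2 * 2 : E) * u = 0 := by linear_combination ht - h
      exact mul_ne_zero (mul_ne_zero h2 h2) u.ne_zero this
    · exact key u rfl ht
  · refine ⟨C b * X + C a, sr_isCoprime _ _ (hq ▸ α.isUnit), ⟨1, by simpa using hq⟩, ?_⟩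
    refine ⟨Ideal.Quotient.mk _ (C (c * u / b)), ?_⟩
    rw [← map_mul, Ideal.Quotient.eq, Ideal.mem_span_singleton]
    refine ⟨C (c / b) * X + C (d / b - c * a / b ^ 2), ?_⟩
    have hbb : (C b : Polynomial E) * C b⁻¹ = 1 := by
      rw [← C_mul, mul_inv_cancel₀ hb, C_1]
    have h5 : c * u / b * (c * u / b) = e - a * (d / b - c * a / b ^ 2) := by
      have : c * (c * (u : E) ^ 2) = c * a ^ 2 - a * b * d + b ^ 2 * e := by
        rw [← hu]; field_simp
      field_simp
      linear_combination this
    rw [← C_mul, h5]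
    conv_lhs => rw [hfe]
    simp only [div_eq_mul_inv, C_mul, C_add, C_sub, ← inv_pow, C_pow]
    linear_combination (-C c * X ^ 2 - C d * X + C c * C a * C b⁻¹ * X) * hbb
end

section
/- Let E be a field of characteristic different from 2 and let v be a valuation on E such that v((E^×)²) is a proper subgroup of v(E^×), i.e., the value group of v is not 2-divisible. Then for every a ∈ E^× with v(a) = 0 and a ≠ 1, the polynomial X(X+1)(X+a) ∈ E[X] is not square-reflexive. -/
open Polynomial

/-- even valuation -/
def EvV {E : Type*} [Field E] {Γ₀ : Type*} [LinearOrderedCommGroupWithZero Γ₀]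
    (v : Valuation E Γ₀) (x : E) : Prop := ∃ b : E, b ≠ 0 ∧ v x = v b ^ 2

section
variable {E : Type*} [Field E] {Γ₀ : Type*} [LinearOrderedCommGroupWithZero Γ₀]
    {v : Valuation E Γ₀}

lemma EvV.mul {x y : E} (hx : EvV v x) (hy : EvV v y) : EvV v (x * y) := by
  obtain ⟨b, hb, h⟩ := hx
  obtain ⟨c, hc, h'⟩ := hy
  exact ⟨b * c, mul_ne_zero hb hc, by rw [map_mul, map_mul, h, h', mul_pow]⟩

lemma EvV.inv {x : E} (hx : EvV v x) : EvV v x⁻¹ := by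
  obtain ⟨b, hb, h⟩ := hx
  exact ⟨b⁻¹, inv_ne_zero hb, by rw [map_inv₀, map_inv₀, h, inv_pow]⟩

lemma EvV.neg {x : E} (hx : EvV v x) : EvV v (-x) := by
  obtain ⟨b, hb, h⟩ := hx
  exact ⟨b, hb, by rw [Valuation.map_neg, h]⟩

lemma EvV.ne {x : E} (hx : EvV v x) : x ≠ 0 := by
  obtain ⟨b, hb, h⟩ := hx
  rintro rfl
  rw [map_zero] at h
  exact hb (by simpa using h.symm)

lemma EvV.sq {b : E} (hb : b ≠ 0) : EvV v (b ^ 2) := ⟨b, hb, by rw [map_pow]⟩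

lemma EvV.of_one {b : E} (hb : v b = 1) : EvV v b := ⟨1, one_ne_zero, by simp [hb]⟩

lemma EvV.right {x y : E} (h : EvV v (x * y)) (hx : EvV v x) : EvV v y := by
  have := hx.inv.mul h
  rwa [inv_mul_cancel_left₀ hx.ne] at this

lemma EvV.left {x y : E} (h : EvV v (x * y)) (hy : EvV v y) : EvV v x := by
  rw [mul_comm] at h
  exact h.right hy

lemma ev_point {a ξ η : E} (hav : v a = 1) (hξ : ξ ≠ 0)
    (h : ξ * (ξ + 1) * (ξ + a) = η ^ 2) : EvV v ξ := by
  have hv : v ξ ≠ 0 := (Valuation.ne_zero_iff v).2 hξ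
  rcases lt_trichotomy (v ξ) 1 with h1 | h1 | h1
  · have e1 : v (ξ + 1) = 1 := by
      rw [Valuation.map_add_eq_of_lt_right v (x := ξ) (y := 1) (by rw [map_one]; exact h1), map_one]
    have e2 : v (ξ + a) = 1 := by
      rw [Valuation.map_add_eq_of_lt_right v (x := ξ) (y := a) (by rw [hav]; exact h1), hav]
    have h2 : v ξ = v η ^ 2 := by
      rw [← map_pow, ← h, map_mul, map_mul, e1, e2]; simp
    refine ⟨η, ?_, h2⟩
    rintro rfl
    simp at h2
    exact hξ h2
  · exact EvV.of_one h1
  · have e1 : v (ξ + 1) = v ξ :=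
      Valuation.map_add_eq_of_lt_left v (x := ξ) (y := 1) (by rw [map_one]; exact h1)
    have e2 : v (ξ + a) = v ξ :=
      Valuation.map_add_eq_of_lt_left v (x := ξ) (y := a) (by rw [hav]; exact h1)
    have h2 : v ξ * v ξ * v ξ = v η ^ 2 := by
      rw [← map_pow, ← h, map_mul, map_mul, e1, e2]
    refine ⟨η / ξ, ?_, ?_⟩
    · refine div_ne_zero ?_ hξ
      rintro rfl
      simp at h2
      exact hξ h2
    · rw [map_div₀, div_pow, ← h2]
      field_simp

lemma natDegree_cubic (a : E) : (X * (X + 1) * (X + C a) : E[X]).natDegree = 3 := by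
  compute_degree!

lemma monic_cubic (a : E) : (X * (X + 1) * (X + C a) : E[X]).Monic := by
  have : (X + 1 : E[X]) = X + C 1 := by simp
  rw [this]
  exact (monic_X.mul (monic_X_add_C 1)).mul (monic_X_add_C a)

lemma lead_step (a : E) (h : E[X]) :
    EvV v (h ^ 2 - X * (X + 1) * (X + C a)).leadingCoeff ∧
      ((h ^ 2 - X * (X + 1) * (X + C a)).natDegree ≤ max 3 (2 * h.natDegree)) := by
  have hd := natDegree_cubic a
  have hm := monic_cubic a
  set f := (X * (X + 1) * (X + C a) : E[X]) with hf
  constructor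
  · have h2 : (h ^ 2).natDegree = 2 * h.natDegree := natDegree_pow h 2
    by_cases hh : 2 ≤ h.natDegree
    · have hlt : f.natDegree < (h ^ 2).natDegree := by omega
      rw [leadingCoeff_sub_of_degree_lt (degree_lt_degree hlt), leadingCoeff_pow]
      refine EvV.sq ?_
      rw [leadingCoeff_ne_zero]
      rintro rfl
      simp at hh
    · have hlt : (h ^ 2).natDegree < f.natDegree := by omega
      rw [leadingCoeff_sub_of_degree_lt' (degree_lt_degree hlt), hm.leadingCoeff]
      exact (EvV.of_one (by simp)).neg
  · refine (natDegree_sub_le _ _).trans ?_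
    rw [natDegree_pow, hd, max_comm]

lemma key {a : E} (hav : v a = 1) : ∀ (n : ℕ) (g h : E[X]), g.natDegree = n → g.eval 0 ≠ 0 →
    EvV v g.leadingCoeff → g ∣ h ^ 2 - X * (X + 1) * (X + C a) → EvV v (g.eval 0) := by
  intro n
  induction n using Nat.strong_induction_on with
  | _ n ih =>
  intro g h hn hg0 hlc hdvd
  have hgne : g ≠ 0 := by rintro rfl; simp at hg0
  by_cases hn2 : n < 2
  · interval_cases n
    · rw [eq_C_of_natDegree_eq_zero hn] at hlc ⊢
      simpa using hlc
    · have hg := eq_X_add_C_of_natDegree_le_one hn.le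
      have hlc' : g.leadingCoeff = g.coeff 1 := by rw [leadingCoeff, hn]
      have hc := hlc.ne
      rw [hlc'] at hlc hc
      have e0 : g.eval 0 = g.coeff 0 := by rw [coeff_zero_eq_eval_zero]
      set ξ := - (g.coeff 1)⁻¹ * g.coeff 0 with hξ
      have hroot : g.eval ξ = 0 := by
        rw [hg]; simp only [eval_add, eval_mul, eval_C, eval_X, hξ]; field_simp; ring
      obtain ⟨k, hk⟩ := hdvd
      have := congrArg (eval ξ) hk
      simp [hroot] at this
      have hev : EvV v ξ := by
        refine ev_point (η := h.eval ξ) hav ?_ (sub_eq_zero.1 this).symm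
        rw [hξ]
        exact mul_ne_zero (neg_ne_zero.2 (inv_ne_zero hc)) (e0 ▸ hg0)
      have : g.eval 0 = - (g.coeff 1 * ξ) := by
        rw [e0, hξ]; field_simp
      rw [this]
      exact (hlc.mul hev).neg
  · push Not at hn2
    obtain ⟨r, hr, hrdvd⟩ : ∃ r : E[X], r.natDegree < n ∧
        g ∣ r ^ 2 - X * (X + 1) * (X + C a) := by
      refine ⟨h % g, ?_, ?_⟩
      · rw [← hn]; exact natDegree_mod_lt _ (by omega)
      · have h1 : g ∣ h ^ 2 - (h % g) ^ 2 := by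
          rw [sq_sub_sq]
          refine Dvd.dvd.mul_left ?_ _
          exact ⟨h / g, by rw [sub_eq_iff_eq_add']; exact (EuclideanDomain.mod_add_div h g).symm⟩
        have := dvd_sub hdvd h1
        convert this using 1
        ring
    obtain ⟨k, hk⟩ := hrdvd
    obtain ⟨hl, hdeg⟩ := lead_step (v := v) a r
    rw [hk, leadingCoeff_mul] at hl
    have hlk := hl.right hlc
    have hkne : k ≠ 0 := leadingCoeff_ne_zero.1 hlk.ne
    rw [hk, natDegree_mul hgne hkne, hn] at hdeg
    have hkn : k.natDegree < n := by omega
    have he := congrArg (eval 0) hk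
    simp at he
    by_cases hk0 : k.eval 0 = 0
    · rw [hk0, mul_zero] at he
      have hr0 : r.eval 0 = 0 := by simpa using he
      obtain ⟨k', rfl⟩ : X ∣ k := by rwa [X_dvd_iff, coeff_zero_eq_eval_zero]
      obtain ⟨r', rfl⟩ : X ∣ r := by rwa [X_dvd_iff, coeff_zero_eq_eval_zero]
      have hk' : X * r' ^ 2 - (X + 1) * (X + C a) = g * k' := by
        apply mul_left_cancel₀ (X_ne_zero (R := E))
        linear_combination hk
      have he' := congrArg (eval 0) hk'
      simp at he'
      have hev : EvV v (g.eval 0 * k'.eval 0) := by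
        rw [← he']; exact (EvV.of_one hav).neg
      have hk'0 : k' ≠ 0 := right_ne_zero_of_mul hkne
      rw [natDegree_X_mul hk'0] at hkn
      refine hev.left (ih k'.natDegree (by omega) k' (X * r') rfl ?_ ?_ ?_)
      · exact right_ne_zero_of_mul hev.ne
      · rwa [leadingCoeff_mul, leadingCoeff_X, one_mul] at hlk
      · exact ⟨g * X, by rw [hk]; ring⟩
    · have hr0 : r.eval 0 ≠ 0 := by
        intro h0
        rw [h0] at he
        exact mul_ne_zero hg0 hk0 (by rw [← he]; simp)
      have hev : EvV v (g.eval 0 * k.eval 0) := by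
        rw [← he]; exact EvV.sq hr0
      exact hev.left (ih _ hkn k r rfl hk0 hlk ⟨g, by rw [hk]; ring⟩)

lemma res_indep {g : E[X]} (hg : g.Monic) (p : E[X]) {N : ℕ} (hN : p.natDegree ≤ N) :
    resultant g p g.natDegree N = resultant g p := by
  obtain ⟨k, rfl⟩ := Nat.exists_eq_add_of_le hN
  rw [resultant_add_right_deg _ _ _ _ _ le_rfl, coeff_natDegree, hg.leadingCoeff, one_pow, one_mul]

lemma res_mul (g p q : E[X]) (hp : p ≠ 0) (hq : q ≠ 0) :
    resultant g (p * q) = resultant g p * resultant g q := by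
  rw [natDegree_mul hp hq, resultant_mul_right _ _ _ _ le_rfl]

lemma res_prod {g h : E[X]} (a : E) (hg : g.Monic) (hdvd : g ∣ h ^ 2 - X * (X + 1) * (X + C a)) :
    ∃ t s : E, (s = 1 ∨ s = -1) ∧ g.eval 0 * g.eval (-1) * g.eval (-a) = s * t ^ 2 := by
  have h1 : resultant g (X * (X + 1) * (X + C a)) = resultant g (h ^ 2) := by
    obtain ⟨k, hk⟩ := hdvd
    have e : h ^ 2 = X * (X + 1) * (X + C a) + g * k := by linear_combination hk
    set N := max (h ^ 2).natDegree (max (X * (X + 1) * (X + C a) : E[X]).natDegree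
      (k.natDegree + g.natDegree)) with hN
    rw [← res_indep hg (N := N) (h ^ 2) (by omega), ← res_indep hg (N := N) _ (by omega), e,
      resultant_add_mul_right _ _ _ _ _ (by omega) le_rfl]
  have hX : resultant g X = (-1) ^ g.natDegree * g.eval 0 := by
    have := resultant_X_sub_C_right g g.natDegree (0 : E) le_rfl
    rw [C_0, sub_zero] at this
    rw [natDegree_X]
    exact this
  have hY (b : E) : resultant g (X + C b) = (-1) ^ g.natDegree * g.eval (-b) := by
    simp
  have hone : (X + 1 : E[X]) = X + C 1 := by simp
  have h2 : resultant g (h ^ 2) = resultant g h ^ 2 := by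
    by_cases hh : h = 0
    · subst hh
      have : (0 : E[X]) ^ 2 = 0 := by simp
      rw [this]
      by_cases hn : g.natDegree = 0 <;> simp [hn]
    · rw [sq, res_mul _ _ _ hh hh, sq]
  rw [hone, res_mul _ _ _ (mul_ne_zero X_ne_zero (X_add_C_ne_zero 1)) (X_add_C_ne_zero a),
    res_mul _ _ _ X_ne_zero (X_add_C_ne_zero 1), hX, hY, hY, h2] at h1
  rcases neg_one_pow_eq_or E g.natDegree with h3 | h3
  · refine ⟨resultant g h, 1, Or.inl rfl, ?_⟩
    rw [h3] at h1
    linear_combination h1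
  · refine ⟨resultant g h, -1, Or.inr rfl, ?_⟩
    rw [h3] at h1
    linear_combination - h1

/-- evaluation at the three roots -/
noncomputable def ev3 (a : E) : E[X] →ₐ[E] E × E × E :=
  (aeval 0).prod ((aeval (-1)).prod (aeval (-a)))

lemma ev3_apply (a : E) (p : E[X]) : ev3 a p = (p.eval 0, p.eval (-1), p.eval (-a)) := by
  simp [ev3, coe_aeval_eq_eval]

lemma ev3_surj {a : E} (ha0 : a ≠ 0) (ha1 : a ≠ 1) : Function.Surjective (ev3 a) := by
  rintro ⟨x, y, z⟩
  have h1 : 1 - a ≠ 0 := sub_ne_zero.2 ha1.symm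
  have h2 : a - 1 ≠ 0 := sub_ne_zero.2 ha1
  refine ⟨C (x / a) * ((X + 1) * (X + C a)) + C (y / (1 - a)) * (X * (X + C a))
    + C (z / (a * (a - 1))) * (X * (X + 1)), ?_⟩
  rw [ev3_apply]
  simp
  refine ⟨by field_simp, ?_, ?_⟩
  · field_simp; ring
  · field_simp; ring

lemma ev3_ker {a : E} (ha0 : a ≠ 0) (ha1 : a ≠ 1) (p : E[X]) :
    ev3 a p = 0 ↔ (X * (X + 1) * (X + C a)) ∣ p := by
  rw [ev3_apply]
  constructor
  · intro h
    simp only [Prod.mk_eq_zero] at h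
    obtain ⟨h0, h1, h2⟩ := h
    obtain ⟨q, rfl⟩ : X ∣ p := by rwa [X_dvd_iff, coeff_zero_eq_eval_zero]
    have hq : q.eval (-1) = 0 := by simpa using h1
    obtain ⟨r, rfl⟩ : X - C (-1) ∣ q := dvd_iff_isRoot.2 hq
    have hr : r.eval (-a) = 0 := by
      have h3 : -a + 1 ≠ 0 := by
        intro h; exact ha1 (by linear_combination - h)
      simpa [ha0, h3] using h2
    obtain ⟨s, rfl⟩ : X - C (-a) ∣ r := dvd_iff_isRoot.2 hr
    exact ⟨s, by simp; ring⟩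
  · rintro ⟨q, rfl⟩
    simp

/-- the Chinese remainder isomorphism -/
noncomputable def crt3 {a : E} (ha0 : a ≠ 0) (ha1 : a ≠ 1) :
    (E[X] ⧸ Ideal.span {(X * (X + 1) * (X + C a) : E[X])}) ≃ₐ[E] E × E × E :=
  AlgEquiv.ofBijective
    (Ideal.Quotient.liftₐ _ (ev3 a) (fun p hp =>
      (ev3_ker ha0 ha1 p).2 (Ideal.mem_span_singleton.1 hp)))
    ⟨by
      rw [injective_iff_map_eq_zero]
      intro x
      obtain ⟨p, rfl⟩ := Ideal.Quotient.mk_surjective x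
      intro h
      rw [Ideal.Quotient.eq_zero_iff_mem, Ideal.mem_span_singleton]
      exact (ev3_ker ha0 ha1 p).1 h, by
      intro y
      obtain ⟨p, hp⟩ := ev3_surj ha0 ha1 y
      exact ⟨Ideal.Quotient.mk _ p, hp⟩⟩

lemma crt3_mk {a : E} (ha0 : a ≠ 0) (ha1 : a ≠ 1) (p : E[X]) :
    crt3 ha0 ha1 (Ideal.Quotient.mk _ p) = (p.eval 0, p.eval (-1), p.eval (-a)) := by
  rw [← ev3_apply]; rfl

lemma norm3 (x y z : E) : Algebra.norm E ((x, y, z) : E × E × E) = x * (y * z) := by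
  rw [Algebra.norm_apply]
  have : Algebra.lmul E (E × E × E) (x, y, z)
      = LinearMap.prodMap (Algebra.lmul E E x)
          (LinearMap.prodMap (Algebra.lmul E E y) (Algebra.lmul E E z)) := by
    apply LinearMap.ext
    rintro ⟨p, q, r⟩
    rfl
  rw [this, LinearMap.det_prodMap, LinearMap.det_prodMap]
  simp

end

theorem statement7 (E : Type*) [Field E] (hchar : ringChar E ≠ 2)
    (Γ₀ : Type*) [LinearOrderedCommGroupWithZero Γ₀] (v : Valuation E Γ₀)
    (hndiv : ∃ π : Eˣ, ∀ b : Eˣ, v (π : E) ≠ v ((b : E) ^ 2))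
    (a : E) (ha0 : a ≠ 0) (hav : v a = 1) (ha1 : a ≠ 1) :
    ¬ IsSquareReflexive (X * (X + 1) * (X + C a)) := by
  rintro ⟨-, H⟩
  obtain ⟨π, hπ⟩ := hndiv
  have hπ' : ¬ EvV v (π : E) := by
    rintro ⟨b, hb, h⟩
    exact hπ (Units.mk0 b hb) (by rw [h, Units.val_mk0, map_pow])
  let e := crt3 ha0 ha1
  let α := Units.mapEquiv e.symm.toMulEquiv
    (MulEquiv.prodUnits.symm (π, MulEquiv.prodUnits.symm (π, 1)))
  have hα : e α = ((π : E), (π : E), (1 : E)) := by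
    change e (e.symm ((π : E), (π : E), (1 : E))) = _
    simp
  obtain ⟨g, hcop, ⟨β, hβ⟩, ⟨r, hr⟩⟩ := H α ⟨π, Or.inl (by
    rw [← Algebra.norm_eq_of_algEquiv e, hα, norm3]; ring)⟩
  have hβu : IsUnit (e β) := β.isUnit.map e
  have h1 := congrArg e hβ
  rw [map_mul, map_pow, hα, crt3_mk] at h1
  generalize e β = b at h1 hβu
  obtain ⟨b0, b1, b2⟩ := b
  simp only [Prod.isUnit_iff, isUnit_iff_ne_zero] at hβu
  obtain ⟨hb0, hb1, hb2⟩ := hβu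
  simp only [Prod.pow_mk, Prod.mk_mul_mk, Prod.mk.injEq, one_mul] at h1
  obtain ⟨g0, g1, g2⟩ := h1
  have hπ0 : (π : E) ≠ 0 := π.ne_zero
  have hgne : g ≠ 0 := by
    rintro rfl
    rw [eval_zero] at g2
    exact pow_ne_zero 2 hb2 g2.symm
  obtain ⟨h, rfl⟩ := Ideal.Quotient.mk_surjective r
  rw [← map_mul, Ideal.Quotient.eq, Ideal.mem_span_singleton] at hr
  have hdvd : g ∣ h ^ 2 - X * (X + 1) * (X + C a) := by
    rw [← dvd_neg]; convert hr using 1; ring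
  -- normalise
  set c := g.leadingCoeff with hc
  have hc0 : c ≠ 0 := leadingCoeff_ne_zero.2 hgne
  set m := g * C c⁻¹ with hm
  have hmon : m.Monic := monic_mul_leadingCoeff_inv hgne
  have hmev (x : E) : m.eval x = g.eval x * c⁻¹ := by simp [hm]
  have hmdvd : m ∣ h ^ 2 - X * (X + 1) * (X + C a) := by
    refine dvd_trans ⟨C c, ?_⟩ hdvd
    rw [hm, mul_assoc, ← C_mul, inv_mul_cancel₀ hc0, C_1, mul_one]
  have hm0 : EvV v (m.eval 0) := by
    refine key hav _ m h rfl ?_ (by rw [hmon.leadingCoeff]; exact EvV.of_one (by simp)) hmdvd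
    rw [hmev, g0]
    exact mul_ne_zero (mul_ne_zero hπ0 (pow_ne_zero 2 hb0)) (inv_ne_zero hc0)
  obtain ⟨t, s, hs, hts⟩ := res_prod a hmon hmdvd
  rw [hmev, hmev, hmev, g0, g1, g2] at hts
  have ht : t ≠ 0 := by
    rintro rfl
    have : (π : E) * b0 ^ 2 * c⁻¹ * (π * b1 ^ 2 * c⁻¹) * (b2 ^ 2 * c⁻¹) ≠ 0 := by simp [hb0, hb1, hb2, hc0]
    exact this (by rw [hts]; simp)
  have hse : EvV v s := by
    rcases hs with rfl | rfl
    · exact EvV.of_one (by simp)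
    · exact (EvV.of_one (by simp)).neg
  have hce : EvV v c := by
    have h5 : c = s * t ^ 2 * (c ^ 2 * (π * b0 * b1 * b2)⁻¹) ^ 2 := by
      rw [← hts]; field_simp
    rw [h5]
    refine (hse.mul (EvV.sq ht)).mul (EvV.sq ?_)
    simp [hb0, hb1, hb2, hc0]
  rw [hmev, g0] at hm0
  exact hπ' ((hm0.left hce.inv).left (EvV.sq hb0))
end

section
/- Let E be a real field, i.e., a field in which −1 is not a sum of squares. Then every square-reflexive polynomial in E[X] has at most three roots in E. -/
open Polynomial

theorem sr_sumSq_fin {K : Type*} [Field K] {a : K} (h : IsSumSq a) :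
    ∃ (n : ℕ) (x : Fin n → K), ∑ i, x i ^ 2 = a := by
  induction h using IsSumSq.rec' with
  | zero => exact ⟨0, Fin.elim0, by simp⟩
  | sq_add hx _ ih =>
    obtain ⟨y, rfl⟩ := hx
    obtain ⟨n, x, rfl⟩ := ih
    exact ⟨n + 1, Fin.cons y x, by simp [Fin.sum_univ_succ, pow_two]⟩

theorem sr_fin_sumSq {K ι : Type*} [Field K] (s : Finset ι) (x : ι → K) :
    IsSumSq (∑ i ∈ s, x i ^ 2) := by
  apply IsSumSq.sum
  intro i _
  exact (IsSquare.sq (x i)).isSumSq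

theorem sr_exists_max (E : Type*) [Field E]
    (hreal : ∀ (n : ℕ) (x : Fin n → E), ∑ i, x i ^ 2 ≠ -1) :
    ∃ K : IntermediateField E (AlgebraicClosure E),
      Maximal (fun K : IntermediateField E (AlgebraicClosure E) =>
      ∀ (n : ℕ) (x : Fin n → AlgebraicClosure E), (∀ i, x i ∈ K) → ∑ i, x i ^ 2 ≠ -1) K := by
  have := zorn_le_nonempty₀ {K : IntermediateField E (AlgebraicClosure E) |
      ∀ (n : ℕ) (x : Fin n → AlgebraicClosure E), (∀ i, x i ∈ K) → ∑ i, x i ^ 2 ≠ -1} ?_ ⊥ ?_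
  · obtain ⟨m, _, hm⟩ := this
    exact ⟨m, hm⟩
  · intro c hc hch y hy
    have : Nonempty c := ⟨⟨y, hy⟩⟩
    have : IsDirectedOrder c := ⟨fun a b => by
      rcases hch.total a.2 b.2 with h | h
      · exact ⟨b, h, le_rfl⟩
      · exact ⟨a, le_rfl, h⟩⟩
    have hd : Directed (· ≤ ·) (fun k : c => (k : IntermediateField E (AlgebraicClosure E))) := by
      intro a b
      obtain ⟨d, h1, h2⟩ := exists_ge_ge a b
      exact ⟨d, h1, h2⟩
    refine ⟨⨆ k : c, (k : IntermediateField E (AlgebraicClosure E)), ?_, fun z hz =>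
      le_iSup (fun k : c => (k : IntermediateField E (AlgebraicClosure E))) ⟨z, hz⟩⟩
    intro n x hx
    have hx' : ∀ i, ∃ k : c, x i ∈ (k : IntermediateField E (AlgebraicClosure E)) := by
      intro i
      have := hx i
      rw [← SetLike.mem_coe, IntermediateField.coe_iSup_of_directed hd] at this
      simpa using this
    choose k hk using hx'
    obtain ⟨M, hM⟩ := Finite.exists_le k
    exact hc M.2 n x (fun i => hM i (hk i))
  · intro n x hx h
    choose y hy using fun i => IntermediateField.mem_bot.1 (hx i)
    apply hreal n y
    apply (algebraMap E (AlgebraicClosure E)).injective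
    simp [hy, h]

theorem sr_exists_K (E : Type*) [Field E]
    (hreal : ∀ (n : ℕ) (x : Fin n → E), ∑ i, x i ^ 2 ≠ -1) :
    ∃ K : IntermediateField E (AlgebraicClosure E), ¬ IsSumSq (-1 : K) ∧
      ∀ p : K[X], Irreducible p → 2 ≤ p.natDegree → ∃ (n : ℕ) (h : Fin n → K[X]),
        (∀ i, (h i).natDegree < p.natDegree) ∧ p ∣ 1 + ∑ i, h i ^ 2 := by
  obtain ⟨K, hK⟩ := sr_exists_max E hreal
  refine ⟨K, ?_, ?_⟩
  · intro h
    obtain ⟨n, x, hx⟩ := sr_sumSq_fin h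
    refine hK.prop n (fun i => (x i : AlgebraicClosure E)) (fun i => (x i).2) ?_
    have := congrArg (fun z : K => (z : AlgebraicClosure E)) hx
    simpa using this
  · intro p hp hd
    obtain ⟨θ, hθ⟩ := IsAlgClosed.exists_aeval_eq_zero (AlgebraicClosure E) p
      (by rw [degree_eq_natDegree hp.ne_zero]; intro h; norm_cast at h; omega)
    have halg : IsAlgebraic K θ := ⟨p, hp.ne_zero, hθ⟩
    have hnot : ¬ (∀ (n : ℕ) (x : Fin n → AlgebraicClosure E),
        (∀ i, x i ∈ (IntermediateField.adjoin K {θ}).restrictScalars E) → ∑ i, x i ^ 2 ≠ -1) := by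
      intro hL
      have hle : K ≤ (IntermediateField.adjoin K {θ}).restrictScalars E := by
        intro z hz
        exact (IntermediateField.adjoin K {θ}).algebraMap_mem ⟨z, hz⟩
      have := hK.le_of_ge hL hle
      have hθK : θ ∈ K := this (IntermediateField.mem_adjoin_simple_self K θ)
      have hr : p.IsRoot (⟨θ, hθK⟩ : K) := by
        rw [IsRoot]
        apply (algebraMap K (AlgebraicClosure E)).injective
        rw [← aeval_algebraMap_apply_eq_algebraMap_eval, map_zero]
        exact hθ
      have : p.natDegree = 1 :=
        natDegree_eq_of_degree_eq_some (degree_eq_one_of_irreducible_of_root hp hr)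
      omega
    push Not at hnot
    obtain ⟨n, x, hx, hs⟩ := hnot
    have hx' : ∀ i, ∃ q : K[X], aeval θ q = x i := by
      intro i
      have h1 : x i ∈ (IntermediateField.adjoin K {θ}).toSubalgebra := hx i
      rw [IntermediateField.adjoin_simple_toSubalgebra_of_isAlgebraic halg,
        Algebra.adjoin_singleton_eq_range_aeval] at h1
      exact h1
    choose q hq using hx'
    refine ⟨n, fun i => q i % p, fun i => natDegree_mod_lt _ (by omega), ?_⟩
    have hm : ∀ i, aeval θ (q i % p) = x i := by
      intro i
      rw [← hq i]
      conv_rhs => rw [← EuclideanDomain.div_add_mod (q i) p]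
      simp [hθ]
    have h0 : aeval θ (1 + ∑ i, (q i % p) ^ 2) = 0 := by
      simp [hm, hs]
    have h2 : minpoly K θ ∣ p := minpoly.dvd K θ hθ
    have h3 : minpoly K θ ∣ 1 + ∑ i, (q i % p) ^ 2 := minpoly.dvd K θ h0
    have h4 : p ∣ minpoly K θ :=
      ((minpoly.irreducible halg.isIntegral).associated_of_dvd hp h2).symm.dvd
    exact h4.trans h3

theorem sr_nonsq {K : Type*} [Field K] (hK : ∀ p : K[X], Irreducible p → 2 ≤ p.natDegree →
      ∃ (n : ℕ) (h : Fin n → K[X]),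
        (∀ i, (h i).natDegree < p.natDegree) ∧ p ∣ 1 + ∑ i, h i ^ 2) (x : K) (hx : ¬ IsSquare x) :
    ∃ a b : K, IsSumSq a ∧ IsSumSq b ∧ a + x * b = -1 := by
  have hd : (X ^ 2 - C x).natDegree = 2 := by simp
  have hirr : Irreducible (X ^ 2 - C x) := by
    rw [X_pow_sub_C_irreducible_iff_of_prime Nat.prime_two]
    intro b hb
    exact hx ⟨b, by rw [← hb, pow_two]⟩
  obtain ⟨n, h, hh, hdvd⟩ := hK _ hirr (by omega)
  refine ⟨∑ i, (h i).coeff 0 ^ 2, ∑ i, (h i).coeff 1 ^ 2, sr_fin_sumSq _ _, sr_fin_sumSq _ _, ?_⟩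
  have hform : ∀ i, h i = C ((h i).coeff 1) * X + C ((h i).coeff 0) := fun i =>
    eq_X_add_C_of_natDegree_le_one (by have := hh i; omega)
  have key : 1 + ∑ i, h i ^ 2 - (X ^ 2 - C x) * C (∑ i, (h i).coeff 1 ^ 2) =
      C (∑ i, 2 * (h i).coeff 0 * (h i).coeff 1) * X +
      C (1 + (∑ i, (h i).coeff 0 ^ 2 + x * ∑ i, (h i).coeff 1 ^ 2)) := by
    have hsum : ∑ i, h i ^ 2 = (X ^ 2 - C x) * C (∑ i, (h i).coeff 1 ^ 2) +
        (C (∑ i, 2 * (h i).coeff 0 * (h i).coeff 1) * X +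
          C (∑ i, (h i).coeff 0 ^ 2 + x * ∑ i, (h i).coeff 1 ^ 2)) := by
      have h2 : (C 2 : K[X]) = 2 := map_ofNat C 2
      simp only [map_sum, map_add, map_mul, map_pow, Finset.mul_sum, Finset.sum_mul,
        ← Finset.sum_add_distrib, h2]
      refine Finset.sum_congr rfl fun i _ => ?_
      generalize hu : C ((h i).coeff 1) = u
      generalize hv : C ((h i).coeff 0) = v
      have := hform i
      rw [hu, hv] at this
      rw [this]
      ring
    rw [hsum, C_add (a := 1), C_1]
    ring
  have hdv : (X ^ 2 - C x) ∣ C (∑ i, 2 * (h i).coeff 0 * (h i).coeff 1) * X +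
      C (1 + (∑ i, (h i).coeff 0 ^ 2 + x * ∑ i, (h i).coeff 1 ^ 2)) := by
    rw [← key]; exact dvd_sub hdvd (dvd_mul_right _ _)
  have hz := eq_zero_of_dvd_of_natDegree_lt hdv (by
    rw [hd]; exact lt_of_le_of_lt natDegree_linear_le (by norm_num))
  have := congrArg (fun p => coeff p 0) hz
  simp only [coeff_add, mul_coeff_zero, coeff_X_zero, mul_zero, coeff_C_zero, coeff_zero,
    zero_add] at this
  linear_combination this

theorem sr_sq_or {K : Type*} [Field K] (h1 : ¬ IsSumSq (-1 : K))
    (hK : ∀ p : K[X], Irreducible p → 2 ≤ p.natDegree →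
      ∃ (n : ℕ) (h : Fin n → K[X]),
        (∀ i, (h i).natDegree < p.natDegree) ∧ p ∣ 1 + ∑ i, h i ^ 2) (x : K) :
    IsSquare x ∨ IsSquare (-x) := by
  by_contra! hcon
  obtain ⟨a, b, ha, hb, hab⟩ := sr_nonsq hK x hcon.1
  obtain ⟨a', b', ha', hb', hab'⟩ := sr_nonsq hK (-x) hcon.2
  have hb0 : b ≠ 0 := by
    rintro rfl
    apply h1
    rw [← hab]; simpa using ha
  apply h1
  have : (-1 : K) = ((1 + a) * b' + a' * b) * b * (b⁻¹ * b⁻¹) := by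
    field_simp
    linear_combination -b' * hab - b * hab'
  rw [this]
  have hone : IsSumSq (1 : K) := IsSquare.one.isSumSq
  exact ((((hone.add ha).mul hb').add (ha'.mul hb)).mul hb).mul (IsSumSq.mul_self _)

theorem sr_order {K : Type*} [Field K] (h1 : ¬ IsSumSq (-1 : K))
    (h2 : ∀ x : K, IsSquare x ∨ IsSquare (-x)) :
    ∃ _ : LinearOrder K, IsStrictOrderedRing K := by
  classical
  have hz : ∀ a : K, IsSquare a → IsSquare (-a) → a = 0 := by
    rintro a ⟨b, hb⟩ ⟨c, hc⟩
    by_contra ha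
    apply h1
    have hb0 : b ≠ 0 := by rintro rfl; simp [hb] at ha
    have : (-1 : K) = (c * b⁻¹) * (c * b⁻¹) := by
      field_simp
      linear_combination hc + hb
    rw [this]; exact IsSumSq.mul_self _
  let C : RingCone K :=
    { carrier := {x | IsSquare x}
      mul_mem' := fun ha hb => IsSquare.mul ha hb
      one_mem' := IsSquare.one
      zero_mem' := IsSquare.zero
      add_mem' := by
        rintro _ _ ⟨a, rfl⟩ ⟨b, rfl⟩
        by_contra hn
        obtain ⟨c, hc⟩ := (h2 (a * a + b * b)).resolve_left hn
        have hc0 : c ≠ 0 := by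
          rintro rfl
          apply hn
          have : a * a + b * b = 0 := by linear_combination -hc
          rw [this]; exact IsSquare.zero
        apply h1
        have : (-1 : K) = (a * c⁻¹) * (a * c⁻¹) + (b * c⁻¹) * (b * c⁻¹) := by
          field_simp
          linear_combination hc
        rw [this]; exact (IsSumSq.mul_self _).add (IsSumSq.mul_self _)
      eq_zero_of_mem_of_neg_mem' := fun {a} ha hb => hz a ha hb }
  have : HasMemOrNegMem C := ⟨fun a => h2 a⟩
  let _ : LinearOrder K := LinearOrder.mkOfAddGroupCone C
  have : IsOrderedRing K := IsOrderedRing.mkOfCone C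
  exact ⟨inferInstance, IsOrderedRing.toIsStrictOrderedRing K⟩

theorem sr_ivt {K : Type*} [Field K] [LinearOrder K] [IsStrictOrderedRing K]
    (hK : ∀ p : K[X], Irreducible p → 2 ≤ p.natDegree →
      ∃ (n : ℕ) (h : Fin n → K[X]),
        (∀ i, (h i).natDegree < p.natDegree) ∧ p ∣ 1 + ∑ i, h i ^ 2) (n : ℕ) :
    ∀ (g : K[X]) (a b : K), g.natDegree < n → a < b → g.eval a * g.eval b < 0 →
      ∃ t, a < t ∧ t < b ∧ g.eval t = 0 := by
  induction n with
  | zero => intro g a b h; omega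
  | succ n ih =>
    intro g a b hg hab hs
    have hg0 : g ≠ 0 := by rintro rfl; simp at hs
    have hd0 : g.natDegree ≠ 0 := by
      intro h
      rw [eq_C_of_natDegree_eq_zero h] at hs
      simp only [eval_C] at hs
      nlinarith [mul_self_nonneg (g.coeff 0)]
    have hnu : ¬ IsUnit g := fun h => hd0 (natDegree_eq_zero_of_isUnit h)
    by_cases hirr : Irreducible g
    · rcases Nat.lt_or_ge g.natDegree 2 with h1 | h2
      · have hform := eq_X_add_C_of_natDegree_le_one (show g.natDegree ≤ 1 by omega)
        set u := g.coeff 1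
        set v := g.coeff 0
        have hu : u ≠ 0 := by
          intro h
          rw [hform, h] at hd0
          simp at hd0
        rw [hform] at hs ⊢
        simp only [eval_add, eval_mul, eval_C, eval_X] at hs ⊢
        have hs2 : (a - (-v / u)) * (b - (-v / u)) < 0 := by
          have : (u * a + v) * (u * b + v) = (u * u) * ((a - (-v / u)) * (b - (-v / u))) := by
            field_simp
            ring
          rw [this] at hs
          by_contra! h
          exact absurd hs (not_lt.2 (mul_nonneg (mul_self_nonneg u) h))
        refine ⟨-v / u, ?_, ?_, by field_simp; ring⟩
        · by_contra! h
          nlinarith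
        · by_contra! h
          nlinarith
      · exfalso
        obtain ⟨m, h, hh, q, hq⟩ := hK g hirr h2
        have hpos : ∀ t, 0 < g.eval t * q.eval t := by
          intro t
          rw [← eval_mul, ← hq]
          simp only [eval_add, eval_one, eval_finsetSum, eval_pow]
          have : 0 ≤ ∑ i, (h i).eval t ^ 2 := Finset.sum_nonneg fun i _ => sq_nonneg _
          linarith
        have hq0 : q ≠ 0 := by
          rintro rfl
          simpa using hpos 0
        have hqd : q.natDegree < n := by
          have h3 : (g * q).natDegree ≤ 2 * (g.natDegree - 1) := by
            rw [← hq]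
            refine (natDegree_add_le _ _).trans (max_le (by simp) ?_)
            refine natDegree_sum_le_of_forall_le _ _ fun i _ => ?_
            refine natDegree_pow_le.trans ?_
            have := hh i
            omega
          rw [natDegree_mul hg0 hq0] at h3
          omega
        obtain ⟨t, _, _, ht⟩ := ih q a b hqd hab (by
          have h3 := mul_pos (hpos a) (hpos b)
          by_contra! h4
          nlinarith [mul_nonpos_of_nonpos_of_nonneg hs.le h4])
        have := hpos t
        rw [ht] at this
        simp at this
    · rw [irreducible_iff] at hirr
      push Not at hirr
      obtain ⟨p, q, hpq, hp, hq⟩ := hirr hnu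
      have hp0 : p ≠ 0 := by rintro rfl; simp [hpq] at hg0
      have hq0 : q ≠ 0 := by rintro rfl; simp [hpq] at hg0
      have hpd : 0 < p.natDegree := by
        by_contra! h
        exact hp (isUnit_iff_degree_eq_zero.2
          (by rw [degree_eq_natDegree hp0]; norm_cast; omega))
      have hqd : 0 < q.natDegree := by
        by_contra! h
        exact hq (isUnit_iff_degree_eq_zero.2
          (by rw [degree_eq_natDegree hq0]; norm_cast; omega))
      have hdd : g.natDegree = p.natDegree + q.natDegree := by rw [hpq, natDegree_mul hp0 hq0]
      rw [hpq] at hs ⊢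
      simp only [eval_mul] at hs ⊢
      have : p.eval a * p.eval b < 0 ∨ q.eval a * q.eval b < 0 := by
        by_contra! h
        nlinarith [mul_nonneg h.1 h.2]
      rcases this with h | h
      · obtain ⟨t, h1, h2, h3⟩ := ih p a b (by omega) hab h
        exact ⟨t, h1, h2, by simp [h3]⟩
      · obtain ⟨t, h1, h2, h3⟩ := ih q a b (by omega) hab h
        exact ⟨t, h1, h2, by simp [h3]⟩

theorem sr_left {K : Type*} [Field K] [LinearOrder K] [IsStrictOrderedRing K]
    (ivt : ∀ (g : K[X]) (a b : K), a < b → g.eval a * g.eval b < 0 →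
      ∃ t, a < t ∧ t < b ∧ g.eval t = 0)
    (F : K[X]) (hF : F ≠ 0) (x y : K) (hxy : x < y) (hx : F.eval x = 0) (hy : F.eval y = 0)
    (hd : 0 < F.derivative.eval y) :
    ∃ r, r < y ∧ F.eval r = 0 ∧ ∀ t, r < t → t < y → F.eval t < 0 := by
  classical
  have hne : (F.roots.toFinset.filter (· < y)).Nonempty :=
    ⟨x, by simp [hF, hx, hxy]⟩
  obtain ⟨r, hr, hmax⟩ := Finset.exists_max_image _ id hne
  simp [hF] at hr hmax
  refine ⟨r, hr.2, hr.1, ?_⟩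
  intro t hrt hty
  by_contra! hn
  have hno : ∀ s, r < s → s < y → F.eval s ≠ 0 := fun s h1 h2 h3 =>
    absurd (hmax s h3 h2) (not_le.2 h1)
  have ht : 0 < F.eval t := lt_of_le_of_ne hn (hno t hrt hty).symm
  obtain ⟨G, hG⟩ := dvd_iff_isRoot.2 (show F.IsRoot y from hy)
  have hGy : G.eval y = F.derivative.eval y := by rw [hG]; simp
  have hFt : F.eval t = (t - y) * G.eval t := by rw [hG]; simp
  have hGt : G.eval t < 0 := by
    by_contra! h
    nlinarith [mul_nonneg (sub_nonneg.2 hty.le) h]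
  obtain ⟨s, h1, h2, h3⟩ := ivt G t y hty (mul_neg_of_neg_of_pos hGt (by rw [hGy]; exact hd))
  exact hno s (hrt.trans h1) h2 (by rw [hG]; simp [h3])

theorem sr_right {K : Type*} [Field K] [LinearOrder K] [IsStrictOrderedRing K]
    (ivt : ∀ (g : K[X]) (a b : K), a < b → g.eval a * g.eval b < 0 →
      ∃ t, a < t ∧ t < b ∧ g.eval t = 0)
    (F : K[X]) (hF : F ≠ 0) (x y : K) (hxy : y < x) (hx : F.eval x = 0) (hy : F.eval y = 0)
    (hd : F.derivative.eval y < 0) :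
    ∃ r, y < r ∧ F.eval r = 0 ∧ ∀ t, y < t → t < r → F.eval t < 0 := by
  classical
  have hne : (F.roots.toFinset.filter (y < ·)).Nonempty :=
    ⟨x, by simp [hF, hx, hxy]⟩
  obtain ⟨r, hr, hmin⟩ := Finset.exists_min_image _ id hne
  simp [hF] at hr hmin
  refine ⟨r, hr.2, hr.1, ?_⟩
  intro t hty hrt
  by_contra! hn
  have hno : ∀ s, y < s → s < r → F.eval s ≠ 0 := fun s h1 h2 h3 =>
    absurd (hmin s h3 h1) (not_le.2 h2)
  have ht : 0 < F.eval t := lt_of_le_of_ne hn (hno t hty hrt).symm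
  obtain ⟨G, hG⟩ := dvd_iff_isRoot.2 (show F.IsRoot y from hy)
  have hGy : G.eval y = F.derivative.eval y := by rw [hG]; simp
  have hFt : F.eval t = (t - y) * G.eval t := by rw [hG]; simp
  have hGt : 0 < G.eval t := by
    by_contra! h
    nlinarith [mul_nonneg (sub_nonneg.2 hty.le) (neg_nonneg.2 h)]
  obtain ⟨s, h1, h2, h3⟩ := ivt G y t hty (mul_neg_of_neg_of_pos (by rw [hGy]; exact hd) hGt)
  exact hno s h1 (h2.trans hrt) (by rw [hG]; simp [h3])

theorem sr_norm_s8 {E Q : Type*} [Field E] [CommRing Q] [Algebra E Q] [Module.Finite E Q]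
    (φ : Q →ₗ[E] E) (e : Q) (h : ∀ q, q * e = φ q • e) (he : φ e = 1) :
    Algebra.norm E (1 - 2 * e) = -1 := by
  have hlin : Algebra.lmul E Q (1 - 2 * e) = LinearMap.transvection φ ((-2 : E) • e) := by
    ext q
    rw [LinearMap.transvection.apply, smul_comm, ← h q, Algebra.smul_def]
    simp [map_ofNat (algebraMap E Q) 2]
    ring
  rw [Algebra.norm_apply, hlin, LinearMap.transvection.det, map_smul, he]
  norm_num

/-- for a simple root `y`: a polynomial that is `-1` at `y`, `1` at all other roots,
with norm `-1`, and square `1`. -/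
theorem sr_refl {E : Type*} [Field E] (f : E[X]) (hf : f ≠ 0) (y : E) (hy : f.eval y = 0)
    (hd : f.derivative.eval y ≠ 0) :
    ∃ P : E[X], P.eval y = -1 ∧
      (∀ (K : Type _) [Field K] [Algebra E K] (r : K), aeval r f = 0 → r ≠ algebraMap E K y →
        aeval r P = 1) ∧
      (Ideal.Quotient.mk (Ideal.span {f}) P) * (Ideal.Quotient.mk (Ideal.span {f}) P) = 1 ∧
      Algebra.norm E (Ideal.Quotient.mk (Ideal.span {f}) P) = -1 := by
  obtain ⟨G, hG⟩ := dvd_iff_isRoot.2 (show f.IsRoot y from hy)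
  have hGy : G.eval y = f.derivative.eval y := by rw [hG]; simp
  rw [← hGy] at hd
  set e : E[X] := C (G.eval y)⁻¹ * G with he
  have hey : e.eval y = 1 := by simp [he, hd]
  have hXe : f ∣ (X - C y) * e := ⟨C (G.eval y)⁻¹, by
    rw [he]; linear_combination (-C (G.eval y)⁻¹) * hG⟩
  have hmul : ∀ p : E[X], Ideal.Quotient.mk (Ideal.span {f}) (p * e) =
      Ideal.Quotient.mk (Ideal.span {f}) (C (p.eval y) * e) := by
    intro p
    rw [Ideal.Quotient.eq, Ideal.mem_span_singleton, ← sub_mul]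
    exact hXe.trans (mul_dvd_mul_right (X_sub_C_dvd_sub_C_eval) _)
  refine ⟨1 - 2 * e, ?_, ?_, ?_, ?_⟩
  · simp [hey]; norm_num
  · intro K _ _ r hr hne
    have : aeval r G = 0 := by
      rw [hG] at hr
      simp at hr
      exact hr.resolve_left (sub_ne_zero.2 hne)
    simp [he, this]
  · have h1 := hmul e
    rw [hey, map_one, one_mul, map_mul] at h1
    simp only [map_sub, map_mul, map_one, map_ofNat]
    linear_combination 4 * h1
  · let φ : (E[X] ⧸ Ideal.span {f}) →ₐ[E] E := Ideal.Quotient.liftₐ _ (aeval y) (by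
      intro a ha
      obtain ⟨b, rfl⟩ := Ideal.mem_span_singleton.1 ha
      simp [hy])
    have hφ : ∀ p : E[X], φ (Ideal.Quotient.mk _ p) = p.eval y := by
      intro p
      simp [φ]
    have : Module.Finite E (E[X] ⧸ Ideal.span {f}) := (AdjoinRoot.powerBasis hf).finite
    have := sr_norm_s8 φ.toLinearMap (Ideal.Quotient.mk (Ideal.span {f}) e) (by
      intro q
      obtain ⟨q, rfl⟩ := Ideal.Quotient.mk_surjective q
      rw [← map_mul, hmul q, AlgHom.toLinearMap_apply, hφ, map_mul, Algebra.smul_def]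
      rfl) (by rw [AlgHom.toLinearMap_apply, hφ, hey])
    rw [← this]
    simp only [map_sub, map_mul, map_one, map_ofNat]

theorem sr_main {E : Type*} [Field E] {K : Type*} [Field K] [Algebra E K]
    [LinearOrder K] [IsStrictOrderedRing K]
    (ivt : ∀ (g : K[X]) (a b : K), a < b → g.eval a * g.eval b < 0 →
      ∃ t, a < t ∧ t < b ∧ g.eval t = 0)
    (f : E[X]) (hf : IsSquareReflexive f) (x y z : E)
    (hx : f.eval x = 0) (hy : f.eval y = 0) (hz : f.eval z = 0)
    (hxy : algebraMap E K x < algebraMap E K y) (hyz : algebraMap E K y < algebraMap E K z) :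
    False := by
  have hf0 : f ≠ 0 := hf.1.ne_zero
  have : CharZero E := (algebraMap E K).charZero
  have hsep : f.Separable := PerfectField.separable_iff_squarefree.2 hf.1
  have hder : ∀ a, f.eval a = 0 → f.derivative.eval a ≠ 0 := by
    intro a ha h
    obtain ⟨u, v, huv⟩ := hsep
    have := congrArg (eval a) huv
    simp [ha, h] at this
  have hdy := hder y hy
  obtain ⟨w, r, hwr, hw, hwy, hr, hry, hneg⟩ : ∃ (w : E) (r : K), r ≠ algebraMap E K w ∧
      f.eval w = 0 ∧ w ≠ y ∧ aeval r f = 0 ∧ r ≠ algebraMap E K y ∧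
      ∀ t, (r < t ∧ t < algebraMap E K y) ∨ (algebraMap E K y < t ∧ t < r) → aeval t f < 0 := by
    have hF : f.map (algebraMap E K) ≠ 0 := (Polynomial.map_ne_zero_iff (algebraMap E K).injective).2 hf0
    have hev : ∀ a, f.eval a = 0 → (f.map (algebraMap E K)).eval (algebraMap E K a) = 0 := by
      intro a ha
      rw [eval_map_algebraMap, aeval_algebraMap_apply_eq_algebraMap_eval, ha, map_zero]
    have hD : (f.map (algebraMap E K)).derivative.eval (algebraMap E K y) ≠ 0 := by
      rw [derivative_map, eval_map_algebraMap, aeval_algebraMap_apply_eq_algebraMap_eval]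
      simpa using hdy
    rcases lt_or_gt_of_ne hD with h | h
    · obtain ⟨r, h1, h2, h3⟩ := sr_right ivt _ hF _ _ hyz (hev z hz) (hev y hy) h
      rw [eval_map_algebraMap] at h2
      simp only [eval_map_algebraMap] at h3
      refine ⟨x, r, (hxy.trans h1).ne', hx, ?_, h2, h1.ne', ?_⟩
      · rintro rfl; exact lt_irrefl _ hxy
      · rintro t (⟨h4, h5⟩ | ⟨h4, h5⟩)
        · exact absurd (h4.trans h5) (not_lt.2 h1.le)
        · exact h3 t h4 h5
    · obtain ⟨r, h1, h2, h3⟩ := sr_left ivt _ hF _ _ hxy (hev x hx) (hev y hy) h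
      rw [eval_map_algebraMap] at h2
      simp only [eval_map_algebraMap] at h3
      refine ⟨z, r, (h1.trans hyz).ne, hz, ?_, h2, h1.ne, ?_⟩
      · rintro rfl; exact lt_irrefl _ hyz
      · rintro t (⟨h4, h5⟩ | ⟨h4, h5⟩)
        · exact h3 t h4 h5
        · exact absurd (h4.trans h5) (not_lt.2 h1.le)
  obtain ⟨P, hP1, hP2, hP3, hP4⟩ := sr_refl f hf0 y hy hdy
  obtain ⟨Q, hQ1, hQ2, hQ3, hQ4⟩ := sr_refl f hf0 w hw (hder w hw)
  let m := Ideal.Quotient.mk (Ideal.span {f})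
  let α : (E[X] ⧸ Ideal.span {f})ˣ := ⟨m (P * Q), m (P * Q),
    by rw [map_mul]; linear_combination (m Q * m Q) * hP3 + hQ3,
    by rw [map_mul]; linear_combination (m Q * m Q) * hP3 + hQ3⟩
  obtain ⟨g, hcop, ⟨β, hβ⟩, hsq⟩ := hf.2 α ⟨1, Or.inl (by
    change Algebra.norm E (m (P * Q)) = _
    rw [map_mul, map_mul, hP4, hQ4]; simp)⟩
  obtain ⟨b, hb⟩ := Ideal.Quotient.mk_surjective (β : E[X] ⧸ Ideal.span {f})
  rw [← hb] at hβ
  change m g = m (P * Q) * (m b) ^ 2 at hβ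
  rw [← map_pow, ← map_mul, Ideal.Quotient.eq, Ideal.mem_span_singleton] at hβ
  obtain ⟨c, hc⟩ := hβ
  have hgv : ∀ s : K, aeval s f = 0 → aeval s g = aeval s P * aeval s Q * aeval s b ^ 2 := by
    intro s hs
    have := congrArg (aeval s) hc
    simp [hs] at this
    linear_combination this
  have hg0 : ∀ s : K, aeval s f = 0 → aeval s g ≠ 0 := by
    intro s hs h
    obtain ⟨u, v, huv⟩ := hcop
    have := congrArg (aeval s) huv
    simp [hs, h] at this
  have hyK : aeval (algebraMap E K y) f = 0 := by
    rw [aeval_algebraMap_apply_eq_algebraMap_eval, hy, map_zero]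
  have hgr : 0 < aeval r g := by
    refine lt_of_le_of_ne ?_ (hg0 r hr).symm
    rw [hgv r hr, hP2 K r hr hry, hQ2 K r hr hwr, one_mul, one_mul]
    exact sq_nonneg _
  have hgy : aeval (algebraMap E K y) g < 0 := by
    refine lt_of_le_of_ne ?_ (hg0 _ hyK)
    rw [hgv _ hyK, aeval_algebraMap_apply_eq_algebraMap_eval, hP1, hQ2 K _ hyK
      (fun h => hwy ((algebraMap E K).injective h).symm)]
    simp
    exact sq_nonneg _
  obtain ⟨t, ht, htg⟩ : ∃ t : K, ((r < t ∧ t < algebraMap E K y) ∨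
      (algebraMap E K y < t ∧ t < r)) ∧ aeval t g = 0 := by
    rcases lt_or_gt_of_ne hry with h | h
    · obtain ⟨t, h1, h2, h3⟩ := ivt (g.map (algebraMap E K)) _ _ h (by
        simp only [eval_map_algebraMap]; exact mul_neg_of_pos_of_neg hgr hgy)
      exact ⟨t, Or.inl ⟨h1, h2⟩, by simpa only [eval_map_algebraMap] using h3⟩
    · obtain ⟨t, h1, h2, h3⟩ := ivt (g.map (algebraMap E K)) _ _ h (by
        simp only [eval_map_algebraMap]; exact mul_neg_of_neg_of_pos hgy hgr)
      exact ⟨t, Or.inr ⟨h1, h2⟩, by simpa only [eval_map_algebraMap] using h3⟩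
  have hft := hneg t ht
  obtain ⟨k, hk⟩ := hsq
  obtain ⟨k, rfl⟩ := Ideal.Quotient.mk_surjective k
  rw [← map_mul, Ideal.Quotient.eq, Ideal.mem_span_singleton] at hk
  obtain ⟨d, hd⟩ := hk
  have := congrArg (aeval t) hd
  simp [htg] at this
  nlinarith [mul_self_nonneg (aeval t k)]

/-- Over a real field (one in which `-1` is not a sum of squares), every square-reflexive
polynomial has at most three roots in the field. -/
theorem statement8 (E : Type*) [Field E]
    (hreal : ∀ (n : ℕ) (x : Fin n → E), ∑ i, x i ^ 2 ≠ -1)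
    (f : Polynomial E) (hf : IsSquareReflexive f) :
    Set.ncard {x : E | f.IsRoot x} ≤ 3 := by
  by_contra! hcon
  obtain ⟨K, h1, hK⟩ := sr_exists_K E hreal
  obtain ⟨_, _⟩ := sr_order h1 (sr_sq_or h1 hK)
  have ivt : ∀ (g : K[X]) (a b : K), a < b → g.eval a * g.eval b < 0 →
      ∃ t, a < t ∧ t < b ∧ g.eval t = 0 := fun g a b =>
    sr_ivt hK (g.natDegree + 1) g a b (Nat.lt_succ_self _)
  have hfin : {x : E | f.IsRoot x}.Finite := Set.finite_of_ncard_ne_zero (by omega)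
  obtain ⟨x, y, z, hx, hy, hz, hxy, hxz, hyz⟩ := (Set.two_lt_ncard_iff hfin).1 (by omega)
  have hinj := (algebraMap E K).injective
  have main := sr_main ivt f hf
  rcases lt_or_gt_of_ne (hinj.ne hxy) with a | a <;>
  rcases lt_or_gt_of_ne (hinj.ne hxz) with b | b <;>
  rcases lt_or_gt_of_ne (hinj.ne hyz) with c | c
  · exact main x y z hx hy hz a c
  · exact main x z y hx hz hy b c
  · exact lt_irrefl _ (a.trans (c.trans b))
  · exact main z x y hz hx hy b a
  · exact main y x z hy hx hz a b
  · exact lt_irrefl _ (a.trans (b.trans c))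
  · exact main y z x hy hz hx c b
  · exact main z y x hz hy hx c a
end

section
/- Let E be a field of characteristic different from 2. Assume that every monic square-free polynomial of degree 4 in E[X] divides some square-reflexive polynomial in E[X]. Then every 3-dimensional regular quadratic form over E is isotropic. -/
open Polynomial

/-- Isotropy of the diagonal quadratic form `⟨a 0, …, a (n-1)⟩`. -/
def IsotropicDiag {R : Type*} [CommRing R] {n : ℕ} (a : Fin n → R) : Prop :=
  ∃ x : Fin n → R, x ≠ 0 ∧ ∑ i, a i * x i ^ 2 = 0


lemma aux_resSq {E : Type*} [Field E] (D G r : E[X]) (hD : D ≠ 0) (hco : IsCoprime D G)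
    (h : D ∣ G - r ^ 2) :
    ∃ z : E, z ≠ 0 ∧ resultant D G = D.leadingCoeff ^ G.natDegree * z ^ 2 := by
  obtain ⟨l, hl⟩ := h
  have hc : D.leadingCoeff ≠ 0 := leadingCoeff_ne_zero.mpr hD
  have hcr : IsCoprime D r := by
    have : IsCoprime D (r ^ 2) := by
      have h2 : G = r ^ 2 + D * l := by rw [← hl]; ring
      rw [h2] at hco
      exact (IsCoprime.add_mul_left_right_iff).1 hco
    exact (IsCoprime.pow_right_iff (by norm_num)).1 this
  set N := G.natDegree + (r.natDegree + r.natDegree) + (l.natDegree + D.natDegree) with hN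
  have h1 : resultant D G D.natDegree N
      = D.leadingCoeff ^ (N - G.natDegree) * resultant D G := by
    have := resultant_add_right_deg D G D.natDegree G.natDegree (N - G.natDegree) le_rfl
    rwa [show G.natDegree + (N - G.natDegree) = N by omega] at this
  have h2 : resultant D G D.natDegree N = resultant D (r * r) D.natDegree N := by
    have := resultant_add_mul_right D (r * r) l D.natDegree N (by omega) le_rfl
    rw [← this, ← hl]; congr 1; ring
  have h3 : resultant D (r * r) D.natDegree N
      = D.leadingCoeff ^ (N - (r.natDegree + r.natDegree)) * (resultant D r * resultant D r) := by
    have := resultant_add_right_deg D (r * r) D.natDegree (r.natDegree + r.natDegree)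
      (N - (r.natDegree + r.natDegree)) natDegree_mul_le
    rw [show (r.natDegree + r.natDegree) + (N - (r.natDegree + r.natDegree)) = N by omega] at this
    rw [this, resultant_mul_right _ _ _ _ le_rfl]; rfl
  have hres := resultant_ne_zero D r hcr
  have key : D.leadingCoeff ^ (N - G.natDegree) * resultant D G = D.leadingCoeff ^ (N - (r.natDegree + r.natDegree)) * (resultant D r * resultant D r) := by
    rw [← h1, h2, h3]
  refine ⟨resultant D r * D.leadingCoeff ^ (l.natDegree + D.natDegree) * (D.leadingCoeff ^ (N - G.natDegree))⁻¹ * D.leadingCoeff ^ r.natDegree , ?_, ?_⟩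
  · have := pow_ne_zero (N - G.natDegree) hc
    have := pow_ne_zero (l.natDegree + D.natDegree) hc
    have := pow_ne_zero r.natDegree hc
    simp_all
  · have e1 : N - G.natDegree = (r.natDegree + r.natDegree) + (l.natDegree + D.natDegree) := by omega
    have e2 : N - (r.natDegree + r.natDegree) = G.natDegree + (l.natDegree + D.natDegree) := by omega
    rw [e1, e2] at key
    rw [e1]
    field_simp
    simp only [pow_add] at key ⊢
    have := pow_ne_zero (l.natDegree) hc
    have := pow_ne_zero (D.natDegree) hc
    have := pow_ne_zero r.natDegree hc
    field_simp
    field_simp at key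
    linear_combination key

lemma aux_recip {E : Type*} [Field E] (F H q g r k : E[X]) (x3 x4 b : E) (hF : F = H * q)
    (hq : q = (X - C x3) * (X - C x4)) (hF0 : F ≠ 0) (hg0 : g ≠ 0) (hco : IsCoprime F g)
    (hr : H ∣ g - r ^ 2) (h3 : g.eval x3 = b * (r.eval x3) ^ 2)
    (h4 : g.eval x4 = b * (r.eval x4) ^ 2) (hk : g ∣ F - k ^ 2) :
    ∃ z : E, z ≠ 0 ∧ F.leadingCoeff ^ g.natDegree =
      (-1) ^ (F.natDegree * g.natDegree) * g.leadingCoeff ^ F.natDegree * z ^ 2 := by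
  have hH0 : H ≠ 0 := by rintro rfl; simp at hF; exact hF0 hF
  have hqm : q.Monic := by rw [hq]; exact (monic_X_sub_C _).mul (monic_X_sub_C _)
  have hq2 : q.natDegree = 2 := by
    rw [hq, (monic_X_sub_C _).natDegree_mul (monic_X_sub_C _)]; simp
  have hlc : F.leadingCoeff = H.leadingCoeff := by
    rw [hF, leadingCoeff_mul, hqm.leadingCoeff, mul_one]
  obtain ⟨z1, hz1, e1⟩ := aux_resSq H g r hH0 (by rw [hF] at hco; exact hco.of_mul_left_left) hr
  obtain ⟨z2, hz2, e2⟩ := aux_resSq g F k hg0 hco.symm hk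
  have e3 : resultant q g = g.eval x3 * g.eval x4 := by
    have := resultant_mul_left (X - C x3) (X - C x4) g g.natDegree le_rfl
    rw [← hq] at this
    rw [hq2]
    simpa using this
  have e4 : resultant F g = resultant H g * resultant q g := by
    have := resultant_mul_left H q g g.natDegree le_rfl
    rw [← hF] at this
    rw [← this]
    rw [hF, natDegree_mul hH0 hqm.ne_zero]
  have e5 := resultant_comm F g F.natDegree g.natDegree
  have hne : g.eval x3 ≠ 0 ∧ g.eval x4 ≠ 0 := by
    have h := resultant_ne_zero F g hco
    rw [e4, e3] at h
    exact ⟨fun h0 => h (by rw [h0]; ring), fun h0 => h (by rw [h0]; ring)⟩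
  rw [h3, h4] at hne
  rw [e4, e3, e1, e2, h3, h4, ← hlc] at e5
  obtain ⟨n1, n2⟩ := hne
  have n3 : b ≠ 0 := left_ne_zero_of_mul n1
  have n4 : eval x3 r ≠ 0 := by rintro h; simp [h] at n1
  have n5 : eval x4 r ≠ 0 := by rintro h; simp [h] at n2
  refine ⟨z2 / (z1 * b * eval x3 r * eval x4 r), by simp_all, ?_⟩
  field_simp
  linear_combination e5

lemma aux_norm {E : Type*} [Field E] (F H q A : E[X]) (b : E) (hF : F = H * q) (hF0 : F ≠ 0)
    (hco : IsCoprime H q) (hq : q.natDegree = 2) (h1 : H ∣ A - 1) (h2 : q ∣ A - C b) :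
    Algebra.norm E (Ideal.Quotient.mk (Ideal.span {F}) A) = b ^ 2 := by
  have hH0 : H ≠ 0 := by rintro rfl; simp at hF; exact hF0 hF
  have hq0 : q ≠ 0 := by rintro rfl; simp at hF; exact hF0 hF
  have i1 : Ideal.span {F} ≤ Ideal.span {H} := by
    rw [Ideal.span_singleton_le_span_singleton, hF]; exact dvd_mul_right _ _
  have i2 : Ideal.span {F} ≤ Ideal.span {q} := by
    rw [Ideal.span_singleton_le_span_singleton, hF]; exact dvd_mul_left _ _
  have : Module.Finite E (E[X] ⧸ Ideal.span {F}) := (AdjoinRoot.powerBasis hF0).finite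
  have : Module.Finite E (E[X] ⧸ Ideal.span {H}) := (AdjoinRoot.powerBasis hH0).finite
  have : Module.Finite E (E[X] ⧸ Ideal.span {q}) := (AdjoinRoot.powerBasis hq0).finite
  let Φ : (E[X] ⧸ Ideal.span {F}) →ₐ[E] (E[X] ⧸ Ideal.span {H}) × (E[X] ⧸ Ideal.span {q}) :=
    (Ideal.Quotient.factorₐ E i1).prod (Ideal.Quotient.factorₐ E i2)
  have hΦ : ∀ p, Φ (Ideal.Quotient.mk _ p) = (Ideal.Quotient.mk _ p, Ideal.Quotient.mk _ p) := by
    intro p; rfl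
  have inj : Function.Injective Φ.toLinearMap := by
    rw [← LinearMap.ker_eq_bot, LinearMap.ker_eq_bot']
    intro m hm
    obtain ⟨p, rfl⟩ := Ideal.Quotient.mk_surjective m
    rw [AlgHom.toLinearMap_apply, hΦ, Prod.mk_eq_zero, Ideal.Quotient.eq_zero_iff_dvd,
      Ideal.Quotient.eq_zero_iff_dvd] at hm
    rw [Ideal.Quotient.eq_zero_iff_dvd, hF]
    exact hco.mul_dvd hm.1 hm.2
  have hfr : Module.finrank E (E[X] ⧸ Ideal.span {F}) =
      Module.finrank E ((E[X] ⧸ Ideal.span {H}) × (E[X] ⧸ Ideal.span {q})) := by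
    rw [Module.finrank_prod, finrank_quotient_span_eq_natDegree,
      finrank_quotient_span_eq_natDegree, finrank_quotient_span_eq_natDegree, hF,
      natDegree_mul hH0 hq0]
  let e := LinearEquiv.ofInjectiveOfFinrankEq Φ.toLinearMap inj hfr
  have he : ∀ x, e x = Φ x := fun x => rfl
  rw [Algebra.norm_apply, ← LinearMap.det_conj _ e]
  have hmap : e.toLinearMap ∘ₗ ((LinearMap.mul E _) (Ideal.Quotient.mk (Ideal.span {F}) A)) ∘ₗ e.symm.toLinearMap
      = LinearMap.prodMap LinearMap.id (b • LinearMap.id) := by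
    apply LinearMap.ext
    intro y
    obtain ⟨x, rfl⟩ := e.surjective y
    obtain ⟨p, rfl⟩ := Ideal.Quotient.mk_surjective x
    have a1 : Ideal.Quotient.mk (Ideal.span {H}) A = 1 := by
      rw [← map_one (Ideal.Quotient.mk (Ideal.span {H})), Ideal.Quotient.mk_eq_mk_iff_sub_mem,
        Ideal.mem_span_singleton]; exact h1
    have a2 : Ideal.Quotient.mk (Ideal.span {q}) A = Ideal.Quotient.mk (Ideal.span {q}) (C b) := by
      rw [Ideal.Quotient.mk_eq_mk_iff_sub_mem, Ideal.mem_span_singleton]; exact h2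
    change e ((Ideal.Quotient.mk (Ideal.span {F}) A) * e.symm (e (Ideal.Quotient.mk (Ideal.span {F}) p))) = _
    rw [LinearEquiv.symm_apply_apply, he, he, map_mul, hΦ, hΦ, a1, a2]
    refine Prod.ext (one_mul _) ?_
    change Ideal.Quotient.mk (Ideal.span {q}) (C b) * Ideal.Quotient.mk (Ideal.span {q}) p
      = b • Ideal.Quotient.mk (Ideal.span {q}) p
    rw [← map_mul, ← smul_eq_C_mul]; rfl
  have : LinearMap.det (LinearMap.prodMap (LinearMap.id : (E[X] ⧸ Ideal.span {H}) →ₗ[E] _) (b • (LinearMap.id : (E[X] ⧸ Ideal.span {q}) →ₗ[E] _))) = b ^ 2 := by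
    rw [LinearMap.det_prodMap, LinearMap.det_id, LinearMap.det_smul, LinearMap.det_id,
      finrank_quotient_span_eq_natDegree, hq]; ring
  rw [← this, ← hmap]
  rfl

lemma aux_coeff {E : Type*} [Field E] (F u : E[X]) (i d : ℕ) (hu : u ∈ degreeLT E i)
    (hF : F.natDegree ≤ d) :
    (∀ m, d + 2 * i ≤ m + 1 → (F * u ^ 2).coeff m = 0) ∧
    (∀ j, i = j + 1 → (F * u ^ 2).coeff (d + 2 * j) = F.coeff d * u.coeff j ^ 2) := by
  rw [mem_degreeLT] at hu
  rcases Nat.eq_zero_or_pos i with h0 | hpos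
  · subst h0
    have : u = 0 := by
      by_contra h
      rw [degree_eq_natDegree h] at hu
      simp at hu
    subst this
    refine ⟨by simp, by omega⟩
  · obtain ⟨j, rfl⟩ : ∃ j, i = j + 1 := ⟨i - 1, by omega⟩
    have hj : u.natDegree ≤ j := by
      by_cases h0 : u = 0
      · simp [h0]
      · rw [degree_eq_natDegree h0] at hu
        have : u.natDegree < j + 1 := by exact_mod_cast hu
        omega
    have hj2 : (u ^ 2).natDegree ≤ 2 * j := natDegree_pow_le_of_le 2 hj
    refine ⟨fun m hm => ?_, fun j' hj' => ?_⟩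
    · apply coeff_eq_zero_of_natDegree_lt
      calc (F * u ^ 2).natDegree ≤ d + 2 * j := natDegree_mul_le_of_le hF hj2
        _ < m := by omega
    · obtain rfl : j = j' := by omega
      rw [coeff_mul_add_eq_of_natDegree_le hF hj2, coeff_pow_of_natDegree_le hj]

lemma aux_dim {E : Type*} [Field E] {M : Type*} [AddCommGroup M] [Module E M]
    [FiniteDimensional E M] (T : E[X] × E[X] × E[X] →ₗ[E] M) (i j l : ℕ)
    (h : Module.finrank E M < i + j + l) :
    ∃ u v w : E[X], ¬ (u = 0 ∧ v = 0 ∧ w = 0) ∧ T (u, v, w) = 0 ∧ u ∈ degreeLT E i ∧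
      v ∈ degreeLT E j ∧ w ∈ degreeLT E l := by
  let S : (degreeLT E i × degreeLT E j × degreeLT E l) →ₗ[E] E[X] × E[X] × E[X] :=
    LinearMap.prodMap (degreeLT E i).subtype
      (LinearMap.prodMap (degreeLT E j).subtype (degreeLT E l).subtype)
  have hf : ∀ i, Module.finrank E (degreeLT E i) = i := fun i => by
    rw [(degreeLTEquiv E i).finrank_eq]; simp
  have hfin : ∀ i, FiniteDimensional E (degreeLT E i) := fun i =>
    Module.Finite.equiv (degreeLTEquiv E i).symm
  have := hfin i
  have := hfin j
  have := hfin l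
  have hk : LinearMap.ker (T ∘ₗ S) ≠ ⊥ := LinearMap.ker_ne_bot_of_finrank_lt (by
    rw [Module.finrank_prod, Module.finrank_prod, hf, hf, hf]; omega)
  obtain ⟨⟨u, v, w⟩, hx, hne⟩ := Submodule.exists_mem_ne_zero_of_ne_bot hk
  refine ⟨u, v, w, ?_, hx, u.2, v.2, w.2⟩
  rintro ⟨h1, h2, h3⟩
  apply hne
  simp only [ZeroMemClass.coe_eq_zero] at h1 h2 h3
  rw [h1, h2, h3]; rfl

lemma aux_exists {E : Type*} [Field E] (F g : E[X]) (hF0 : F ≠ 0) (hg0 : g ≠ 0)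
    (hrec : ∃ z : E, z ≠ 0 ∧ F.leadingCoeff ^ g.natDegree =
      (-1) ^ (F.natDegree * g.natDegree) * g.leadingCoeff ^ F.natDegree * z ^ 2)
    {M : Type*} [AddCommGroup M] [Module E M]
    [FiniteDimensional E M] (T : E[X] × E[X] × E[X] →ₗ[E] M)
    (hM : Module.finrank E M + 1 ≤ F.natDegree + g.natDegree) :
    ∃ u v w : E[X], ¬ (u = 0 ∧ v = 0 ∧ w = 0) ∧ T (u, v, w) = 0 ∧
      ∀ m, F.natDegree + g.natDegree ≤ m + 1 → (u ^ 2 - F * v ^ 2 - g * w ^ 2).coeff m = 0 := by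
  obtain ⟨z, hz, hrec⟩ := hrec
  have hc : F.leadingCoeff ≠ 0 := leadingCoeff_ne_zero.mpr hF0
  have hc' : g.leadingCoeff ≠ 0 := leadingCoeff_ne_zero.mpr hg0
  have hFd : F.coeff F.natDegree = F.leadingCoeff := rfl
  have hgd : g.coeff g.natDegree = g.leadingCoeff := rfl
  generalize F.leadingCoeff = c at *
  generalize g.leadingCoeff = γ at *
  have hFl : F.natDegree ≤ F.natDegree := le_rfl
  have hgl : g.natDegree ≤ g.natDegree := le_rfl
  generalize hdF : F.natDegree = dF at hrec hM hFd hFl ⊢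
  generalize hdg : g.natDegree = dg at hrec hM hgd hgl ⊢
  have h1l : (1 : E[X]).natDegree ≤ 0 := by simp
  rcases Nat.even_or_odd' dF with ⟨p, rfl | rfl⟩ <;> rcases Nat.even_or_odd' dg with ⟨s, rfl | rfl⟩
  · obtain ⟨u, v, w, hne, hT, hu, hv, hw⟩ := aux_dim T (p + s) s p (by omega)
    refine ⟨u, v, w, hne, hT, fun m hm => ?_⟩
    have e1 := (aux_coeff 1 u _ 0 hu h1l).1 m (by omega)
    have e2 := (aux_coeff F v _ _ hv (hdF.le.trans hFl)).1 m (by omega)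
    have e3 := (aux_coeff g w _ _ hw (hdg.le.trans hgl)).1 m (by omega)
    rw [one_mul] at e1
    rw [coeff_sub, coeff_sub, e1, e2, e3]; ring
  · have hsq : c = (γ ^ p * z / c ^ s) ^ 2 := by
      rw [show 2 * p * (2 * s + 1) = 2 * (p * (2 * s + 1)) by ring, pow_mul (-1 : E) 2] at hrec
      simp only [even_two, Even.neg_pow, one_pow, one_mul] at hrec
      field_simp
      linear_combination hrec
    generalize γ ^ p * z / c ^ s = κ at hsq
    obtain ⟨u, v, w, hne, hT, hu, hv, hw⟩ := aux_dim (T.prod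
      ((lcoeff E (p + s)) ∘ₗ (LinearMap.fst E _ _) - κ • (lcoeff E s) ∘ₗ (LinearMap.fst E _ _) ∘ₗ (LinearMap.snd E _ _)))
      (p + s + 1) (s + 1) p (by rw [Module.finrank_prod, Module.finrank_self]; omega)
    replace hT : T (u, v, w) = 0 ∧ u.coeff (p + s) - κ * v.coeff s = 0 :=
      ⟨congrArg Prod.fst hT, congrArg Prod.snd hT⟩
    refine ⟨u, v, w, hne, hT.1, fun m hm => ?_⟩
    have e1 := (aux_coeff 1 u _ 0 hu h1l)
    have e2 := (aux_coeff F v _ _ hv (hdF.le.trans hFl))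
    have e3 := (aux_coeff g w _ _ hw (hdg.le.trans hgl))
    rw [one_mul] at e1
    rcases Nat.lt_or_ge (2 * p + (2 * s + 1)) (m + 1) with h | h
    · rw [coeff_sub, coeff_sub, e1.1 _ (by omega), e2.1 _ (by omega), e3.1 _ (by omega)]; ring
    · obtain rfl : m = 0 + 2 * (p + s) := by omega
      have e2' := e2.2 s rfl
      rw [show 2 * p + 2 * s = 0 + 2 * (p + s) by ring] at e2'
      rw [coeff_sub, coeff_sub, e1.2 _ rfl, e2', e3.1 _ (by omega), hFd, hsq,
        sub_eq_zero.1 hT.2]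
      simp; ring
  · have hsq : γ = (c ^ s / (γ ^ p * z)) ^ 2 := by
      rw [show (2 * p + 1) * (2 * s) = 2 * (s * (2 * p + 1)) by ring, pow_mul (-1 : E) 2] at hrec
      simp only [even_two, Even.neg_pow, one_pow, one_mul] at hrec
      field_simp
      linear_combination -hrec
    generalize c ^ s / (γ ^ p * z) = κ at hsq
    obtain ⟨u, v, w, hne, hT, hu, hv, hw⟩ := aux_dim (T.prod
      ((lcoeff E (p + s)) ∘ₗ (LinearMap.fst E _ _) - κ • (lcoeff E p) ∘ₗ (LinearMap.snd E _ _) ∘ₗ (LinearMap.snd E _ _)))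
      (p + s + 1) s (p + 1) (by rw [Module.finrank_prod, Module.finrank_self]; omega)
    replace hT : T (u, v, w) = 0 ∧ u.coeff (p + s) - κ * w.coeff p = 0 :=
      ⟨congrArg Prod.fst hT, congrArg Prod.snd hT⟩
    refine ⟨u, v, w, hne, hT.1, fun m hm => ?_⟩
    have e1 := (aux_coeff 1 u _ 0 hu h1l)
    have e2 := (aux_coeff F v _ _ hv (hdF.le.trans hFl))
    have e3 := (aux_coeff g w _ _ hw (hdg.le.trans hgl))
    rw [one_mul] at e1
    rcases Nat.lt_or_ge (2 * p + 1 + 2 * s) (m + 1) with h | h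
    · rw [coeff_sub, coeff_sub, e1.1 _ (by omega), e2.1 _ (by omega), e3.1 _ (by omega)]; ring
    · obtain rfl : m = 0 + 2 * (p + s) := by omega
      have e3' := e3.2 p rfl
      rw [show 2 * s + 2 * p = 0 + 2 * (p + s) by ring] at e3'
      rw [coeff_sub, coeff_sub, e1.2 _ rfl, e3', e2.1 _ (by omega), hgd, hsq,
        sub_eq_zero.1 hT.2]
      simp; ring
  · have hsq : c = - γ * (γ ^ p * z / c ^ s) ^ 2 := by
      rw [show (2 * p + 1) * (2 * s + 1) = 2 * (p * (2 * s + 1) + s) + 1 by ring, pow_succ (-1 : E), pow_mul (-1 : E) 2] at hrec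
      simp only [even_two, Even.neg_pow, one_pow, one_mul] at hrec
      field_simp
      linear_combination hrec
    generalize γ ^ p * z / c ^ s = κ at hsq
    obtain ⟨u, v, w, hne, hT, hu, hv, hw⟩ := aux_dim (T.prod
      ((lcoeff E p) ∘ₗ (LinearMap.snd E _ _) ∘ₗ (LinearMap.snd E _ _) - κ • (lcoeff E s) ∘ₗ (LinearMap.fst E _ _) ∘ₗ (LinearMap.snd E _ _)))
      (p + s + 1) (s + 1) (p + 1) (by rw [Module.finrank_prod, Module.finrank_self]; omega)
    replace hT : T (u, v, w) = 0 ∧ w.coeff p - κ * v.coeff s = 0 :=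
      ⟨congrArg Prod.fst hT, congrArg Prod.snd hT⟩
    refine ⟨u, v, w, hne, hT.1, fun m hm => ?_⟩
    have e1 := (aux_coeff 1 u _ 0 hu h1l)
    have e2 := (aux_coeff F v _ _ hv (hdF.le.trans hFl))
    have e3 := (aux_coeff g w _ _ hw (hdg.le.trans hgl))
    rw [one_mul] at e1
    rcases Nat.lt_or_ge (2 * p + 1 + (2 * s + 1)) (m + 1) with h | h
    · rw [coeff_sub, coeff_sub, e1.1 _ (by omega), e2.1 _ (by omega), e3.1 _ (by omega)]; ring
    · obtain rfl : m = 2 * (p + s) + 1 := by omega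
      have e2' := e2.2 s rfl
      have e3' := e3.2 p rfl
      rw [show 2 * p + 1 + 2 * s = 2 * (p + s) + 1 by ring] at e2'
      rw [show 2 * s + 1 + 2 * p = 2 * (p + s) + 1 by ring] at e3'
      rw [coeff_sub, coeff_sub, e1.1 _ (by omega), e2', e3', hFd, hgd, hsq,
        sub_eq_zero.1 hT.2]
      ring

lemma aux_descent {E : Type*} [Field E] (F F1 g : E[X]) (x b s : E) (hb : ¬ IsSquare b)
    (hF : F = (X - C x) * F1) (hF1 : F1.eval x ≠ 0) (hg : g.eval x = b * s ^ 2) (hs : s ≠ 0)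
    (N : ℕ) : ∀ u v w : E[X], u ^ 2 = F * v ^ 2 + g * w ^ 2 →
      (X - C x) ^ N ∣ u ∧ (X - C x) ^ N ∣ v ∧ (X - C x) ^ N ∣ w := by
  induction N with
  | zero => intro u v w _; simp
  | succ N ih =>
    intro u v w h
    have hx := congrArg (eval x) h
    simp only [hF, eval_pow, eval_add, eval_mul, eval_sub, eval_X, eval_C, sub_self, zero_mul,
      zero_add, hg] at hx
    have hw : w.eval x = 0 := by
      by_contra hw
      apply hb
      refine ⟨u.eval x / (s * w.eval x), ?_⟩
      field_simp
      linear_combination -hx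
    have hu : u.eval x = 0 := by simpa [hw] using hx
    obtain ⟨u', rfl⟩ := dvd_iff_isRoot.2 hu
    obtain ⟨w', rfl⟩ := dvd_iff_isRoot.2 hw
    have ht : (X - C x) ≠ 0 := X_sub_C_ne_zero x
    have h2 : (X - C x) * u' ^ 2 = F1 * v ^ 2 + g * ((X - C x) * w' ^ 2) := by
      apply mul_left_cancel₀ ht
      rw [hF] at h
      linear_combination h
    have hx2 := congrArg (eval x) h2
    simp only [eval_pow, eval_add, eval_mul, eval_sub, eval_X, eval_C, sub_self, zero_mul,
      mul_zero, add_zero] at hx2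
    have hv : v.eval x = 0 := by
      have := hx2.symm
      simpa [hF1] using this
    obtain ⟨v', rfl⟩ := dvd_iff_isRoot.2 hv
    obtain ⟨a1, a2, a3⟩ := ih u' v' w' (by
      apply mul_left_cancel₀ (pow_ne_zero 2 ht)
      linear_combination h)
    simp only [pow_succ']
    exact ⟨mul_dvd_mul_left _ a1, mul_dvd_mul_left _ a2, mul_dvd_mul_left _ a3⟩

lemma aux_descent' {E : Type*} [Field E] (F F1 g : E[X]) (x b s : E) (hb : ¬ IsSquare b)
    (hF : F = (X - C x) * F1) (hF1 : F1.eval x ≠ 0) (hg : g.eval x = b * s ^ 2) (hs : s ≠ 0)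
    (u v w : E[X]) (h : u ^ 2 = F * v ^ 2 + g * w ^ 2) : u = 0 ∧ v = 0 ∧ w = 0 := by
  have key : ∀ p : E[X], (∀ N, (X - C x) ^ N ∣ p) → p = 0 := fun p hp =>
    eq_zero_of_dvd_of_natDegree_lt (hp (p.natDegree + 1)) (by
      rw [natDegree_pow, natDegree_X_sub_C]; omega)
  have H := fun N => aux_descent F F1 g x b s hb hF hF1 hg hs N u v w h
  exact ⟨key _ fun N => (H N).1, key _ fun N => (H N).2.1, key _ fun N => (H N).2.2⟩

lemma aux_point {E : Type*} [Field E] (F H q H1 F1 g r k : E[X]) (x1 x3 b : E)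
    (hb : ¬ IsSquare b) (hF : F = H * q) (hF0 : F ≠ 0) (hg0 : g ≠ 0) (hq2 : q.natDegree = 2)
    (hH : H = (X - C x1) * H1) (hH1 : H1.eval x1 ≠ 0)
    (hF3 : F = (X - C x3) * F1) (hF1 : F1.eval x3 ≠ 0) (hco : IsCoprime F g)
    (hr : H ∣ g - r ^ 2) (h3 : g.eval x3 = b * (r.eval x3) ^ 2) (hk : g ∣ F - k ^ 2)
    (hrec : ∃ z : E, z ≠ 0 ∧ F.leadingCoeff ^ g.natDegree =
      (-1) ^ (F.natDegree * g.natDegree) * g.leadingCoeff ^ F.natDegree * z ^ 2) :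
    ∃ c d : E, c ≠ 0 ∧ c = - q.eval x1 * d ^ 2 ∧
      ∃ x z, c * (g.eval x3 * H.eval x3) = x ^ 2 - b * z ^ 2 := by
  have hH0 : H ≠ 0 := by rintro rfl; simp at hF; exact hF0 hF
  have hq0 : q ≠ 0 := by rintro rfl; simp at hF; exact hF0 hF
  have hfinH : Module.Finite E (E[X] ⧸ Ideal.span {H}) := (AdjoinRoot.powerBasis hH0).finite
  have hfing : Module.Finite E (E[X] ⧸ Ideal.span {g}) := (AdjoinRoot.powerBasis hg0).finite
  have hdeg : F.natDegree = H.natDegree + 2 := by rw [hF, natDegree_mul hH0 hq0, hq2]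
  have hcoHg : IsCoprime H g := by rw [hF] at hco; exact hco.of_mul_left_left
  have gne : ∀ x, F.eval x = 0 → g.eval x ≠ 0 := by
    intro x h1 h2
    obtain ⟨a, b, hab⟩ := hco
    have := congrArg (eval x) hab
    simp [h1, h2] at this
  let T : E[X] × E[X] × E[X] →ₗ[E] (E[X] ⧸ Ideal.span {g}) × (E[X] ⧸ Ideal.span {H}) × E :=
    LinearMap.prod ((Ideal.Quotient.mkₐ E (Ideal.span {g})).toLinearMap ∘ₗ
        (LinearMap.fst E _ _ - LinearMap.mulLeft E k ∘ₗ LinearMap.fst E _ _ ∘ₗ LinearMap.snd E _ _))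
      (LinearMap.prod ((Ideal.Quotient.mkₐ E (Ideal.span {H})).toLinearMap ∘ₗ
        (LinearMap.fst E _ _ - LinearMap.mulLeft E r ∘ₗ LinearMap.snd E _ _ ∘ₗ LinearMap.snd E _ _))
        (leval x1 ∘ₗ LinearMap.snd E _ _ ∘ₗ LinearMap.snd E _ _))
  obtain ⟨u, v, w, hne, hT, hcoef⟩ := aux_exists F g hF0 hg0 hrec T (by
    rw [Module.finrank_prod, Module.finrank_prod, finrank_quotient_span_eq_natDegree,
      finrank_quotient_span_eq_natDegree, Module.finrank_self]; omega)
  have t1 : Ideal.Quotient.mk (Ideal.span {g}) (u - k * v) = 0 := congrArg Prod.fst hT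
  have t2 : Ideal.Quotient.mk (Ideal.span {H}) (u - r * w) = 0 :=
    congrArg (fun x => x.2.1) hT
  have t3 : w.eval x1 = 0 := congrArg (fun x => x.2.2) hT
  rw [Ideal.Quotient.eq_zero_iff_dvd] at t1 t2
  have d1 : g ∣ u ^ 2 - F * v ^ 2 - g * w ^ 2 := by
    have : u ^ 2 - F * v ^ 2 - g * w ^ 2
        = (u - k * v) * (u + k * v) - (F - k ^ 2) * v ^ 2 - g * w ^ 2 := by ring
    rw [this]
    exact dvd_sub (dvd_sub (t1.mul_right _) (hk.mul_right _)) (dvd_mul_right _ _)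
  have d2 : H ∣ u ^ 2 - F * v ^ 2 - g * w ^ 2 := by
    have : u ^ 2 - F * v ^ 2 - g * w ^ 2
        = (u - r * w) * (u + r * w) - (g - r ^ 2) * w ^ 2 - H * (q * v ^ 2) := by rw [hF]; ring
    rw [this]
    exact dvd_sub (dvd_sub (t2.mul_right _) (hr.mul_right _)) (dvd_mul_right _ _)
  obtain ⟨l, hl⟩ := hcoHg.symm.mul_dvd d1 d2
  have hφ0 : u ^ 2 - F * v ^ 2 - g * w ^ 2 ≠ 0 := by
    intro h0
    apply hne
    apply aux_descent' F F1 g x3 b (r.eval x3) hb hF3 hF1 h3 ?_ u v w (by linear_combination h0)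
    intro h
    apply gne x3 (by rw [hF3]; simp)
    rw [h3, h]; ring
  have hl0 : l ≠ 0 := by rintro rfl; rw [mul_zero] at hl; exact hφ0 hl
  have hnd : (u ^ 2 - F * v ^ 2 - g * w ^ 2).natDegree + 1 < F.natDegree + g.natDegree := by
    by_contra hcon
    have := hcoef _ (not_lt.1 hcon)
    rw [coeff_natDegree, leadingCoeff_eq_zero] at this
    exact hφ0 this
  have hlc : l.natDegree = 0 := by
    rw [hl, natDegree_mul (mul_ne_zero hg0 hH0) hl0, natDegree_mul hg0 hH0] at hnd
    omega
  obtain ⟨c, rfl⟩ : ∃ c, l = C c := ⟨_, eq_C_of_natDegree_eq_zero hlc⟩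
  have hc0 : c ≠ 0 := by rintro rfl; simp at hl0
  have hu1 : u.eval x1 = 0 := by
    obtain ⟨m, hm⟩ := t2
    have := congrArg (eval x1) hm
    simpa [hH, t3] using this
  obtain ⟨u', rfl⟩ := dvd_iff_isRoot.2 hu1
  obtain ⟨w', rfl⟩ := dvd_iff_isRoot.2 t3
  have h2 : (X - C x1) * u' ^ 2 - H1 * q * v ^ 2 - g * ((X - C x1) * w' ^ 2) = g * H1 * C c := by
    apply mul_left_cancel₀ (X_sub_C_ne_zero x1)
    rw [hF, hH] at hl
    linear_combination hl
  have e2 := congrArg (eval x1) h2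
  simp only [eval_mul, eval_sub, eval_pow, eval_X, eval_C, sub_self, zero_mul, mul_zero,
    sub_zero, zero_sub] at e2
  have hgr : g.eval x1 = r.eval x1 ^ 2 := by
    obtain ⟨m, hm⟩ := hr
    have := congrArg (eval x1) hm
    simp [hH] at this
    linear_combination this
  have hr1 : r.eval x1 ≠ 0 := by
    intro h
    apply gne x1 (by rw [hF, hH]; simp)
    rw [hgr, h]; ring
  refine ⟨c, v.eval x1 / r.eval x1, hc0, ?_, ?_⟩
  · rw [hgr] at e2
    have : c * r.eval x1 ^ 2 = - q.eval x1 * v.eval x1 ^ 2 := by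
      apply mul_left_cancel₀ hH1
      linear_combination -e2
    field_simp
    linear_combination this
  · have e3 := congrArg (eval x3) hl
    have : F.eval x3 = 0 := by rw [hF3]; simp
    refine ⟨eval x3 ((X - C x1) * u'), eval x3 r * eval x3 ((X - C x1) * w'), ?_⟩
    simp only [eval_sub, eval_mul, eval_pow, eval_C, eval_X, this, zero_mul, sub_zero, h3] at e3 ⊢
    linear_combination -e3

lemma aux_main {E : Type*} [Field E]
    (hdiv : ∀ f : Polynomial E, f.Monic → Squarefree f → f.natDegree = 4 →
      ∃ g : Polynomial E, IsSquareReflexive g ∧ f ∣ g)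
    (b x1 x2 x3 x4 : E) (hb : ¬ IsSquare b) (h12 : x1 ≠ x2) (h13 : x1 ≠ x3) (h14 : x1 ≠ x4)
    (h23 : x2 ≠ x3) (h24 : x2 ≠ x4) (h34 : x3 ≠ x4) :
    ∃ d x z : E, d ≠ 0 ∧
      ((x1 - x3) * (x1 - x4) * ((x2 - x3) * (x2 - x4))) * d ^ 2 = x ^ 2 - b * z ^ 2 := by
  have hb0 : b ≠ 0 := by rintro rfl; exact hb (IsSquare.zero)
  have hcop : ∀ x y : E, x ≠ y → IsCoprime (X - C x) (X - C y) := fun x y h =>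
    isCoprime_X_sub_C_of_isUnit_sub (sub_ne_zero.2 h).isUnit
  obtain ⟨F, ⟨hsq, hrefl⟩, h, hFh⟩ := hdiv ((X - C x1) * (X - C x2) * ((X - C x3) * (X - C x4)))
    (((monic_X_sub_C _).mul (monic_X_sub_C _)).mul ((monic_X_sub_C _).mul (monic_X_sub_C _)))
    (by
      apply Separable.squarefree
      refine Separable.mul (Separable.mul separable_X_sub_C separable_X_sub_C (hcop _ _ h12))
        (Separable.mul separable_X_sub_C separable_X_sub_C (hcop _ _ h34)) ?_
      exact IsCoprime.mul_left (IsCoprime.mul_right (hcop _ _ h13) (hcop _ _ h14))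
        (IsCoprime.mul_right (hcop _ _ h23) (hcop _ _ h24)))
    (by
      rw [((monic_X_sub_C _).mul (monic_X_sub_C _)).natDegree_mul ((monic_X_sub_C _).mul (monic_X_sub_C _)),
        (monic_X_sub_C _).natDegree_mul (monic_X_sub_C _),
        (monic_X_sub_C _).natDegree_mul (monic_X_sub_C _)]
      simp)
  have hF0 : F ≠ 0 := hsq.ne_zero
  obtain ⟨q, hq⟩ : ∃ q, q = (X - C x3) * (X - C x4) := ⟨_, rfl⟩
  obtain ⟨H, hH⟩ : ∃ H, H = (X - C x1) * (X - C x2) * h := ⟨_, rfl⟩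
  have hF : F = H * q := by rw [hFh, hH, hq]; ring
  have hq2 : q.natDegree = 2 := by
    rw [hq, (monic_X_sub_C _).natDegree_mul (monic_X_sub_C _)]; simp
  have hsimple : ∀ (x : E) (P : E[X]), (X - C x) * P ∣ F → P.eval x ≠ 0 := by
    intro x P hP h0
    obtain ⟨P', rfl⟩ := dvd_iff_isRoot.2 h0
    have := hsq (X - C x) (dvd_trans ⟨P', by ring⟩ hP)
    exact not_isUnit_X_sub_C x this
  have hcoHq : IsCoprime H q := by
    rw [hF] at hsq
    exact (squarefree_mul_iff.1 hsq).1.isCoprime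
  obtain ⟨m', m, hm⟩ := id hcoHq
  -- the unit
  obtain ⟨A, hA⟩ : ∃ A, A = 1 + (C b - 1) * (m' * H) := ⟨_, rfl⟩
  have hA1 : H ∣ A - 1 := ⟨(C b - 1) * m', by rw [hA]; ring⟩
  have hAb : q ∣ A - C b := ⟨-(C b - 1) * m, by rw [hA]; linear_combination (C b - 1) * hm⟩
  have hbb : (C b : E[X]) * C b⁻¹ = 1 := by rw [← C_mul, mul_inv_cancel₀ hb0, C_1]
  have hunit : Ideal.Quotient.mk (Ideal.span {F}) A *
      Ideal.Quotient.mk (Ideal.span {F}) (1 + (C b⁻¹ - 1) * (m' * H)) = 1 := by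
    rw [← map_mul, ← map_one (Ideal.Quotient.mk (Ideal.span {F})),
      Ideal.Quotient.mk_eq_mk_iff_sub_mem, Ideal.mem_span_singleton]
    refine ⟨(C b + C b⁻¹ - 2) * (m' * m), ?_⟩
    rw [hA, hF]
    linear_combination (m' * H) ^ 2 * hbb - (C b + C b⁻¹ - 2) * (m' * H) * hm
  let α : (E[X] ⧸ Ideal.span {F})ˣ := Units.mkOfMulEqOne _ _ hunit
  have hα : (α : E[X] ⧸ Ideal.span {F}) = Ideal.Quotient.mk (Ideal.span {F}) A := rfl
  obtain ⟨g, hco, ⟨β, hβ⟩, hsqg⟩ := hrefl α ⟨Units.mk0 b hb0, Or.inl (by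
    rw [hα]; exact aux_norm F H q A b hF hF0 hcoHq hq2 hA1 hAb)⟩
  obtain ⟨r, hr⟩ := Ideal.Quotient.mk_surjective (β : E[X] ⧸ Ideal.span {F})
  rw [hα, ← hr, ← map_pow, ← map_mul, Ideal.Quotient.mk_eq_mk_iff_sub_mem,
    Ideal.mem_span_singleton] at hβ
  obtain ⟨k', hk'⟩ := hsqg
  obtain ⟨k, rfl⟩ := Ideal.Quotient.mk_surjective k'
  rw [← map_mul, Ideal.Quotient.mk_eq_mk_iff_sub_mem, Ideal.mem_span_singleton, ← pow_two] at hk'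
  have hg0 : g ≠ 0 := by
    rintro rfl
    rw [isCoprime_zero_right] at hco
    exact not_isUnit_X_sub_C x1 (isUnit_of_dvd_unit ⟨(X - C x2) * h * q, by rw [hF, hH]; ring⟩ hco)
  have hrH : H ∣ g - r ^ 2 := by
    have : g - r ^ 2 = (g - A * r ^ 2) + (A - 1) * r ^ 2 := by ring
    rw [this]
    exact dvd_add ((Dvd.intro _ hF.symm).trans hβ) (hA1.mul_right _)
  have hrq : q ∣ g - C b * r ^ 2 := by
    have : g - C b * r ^ 2 = (g - A * r ^ 2) + (A - C b) * r ^ 2 := by ring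
    rw [this]
    exact dvd_add ((Dvd.intro_left _ hF.symm).trans hβ) (hAb.mul_right _)
  have hev : ∀ x, q.eval x = 0 → g.eval x = b * r.eval x ^ 2 := by
    intro x hx
    obtain ⟨n, hn⟩ := hrq
    have := congrArg (eval x) hn
    simp [hx] at this
    linear_combination this
  have h3 := hev x3 (by rw [hq]; simp)
  have h4 := hev x4 (by rw [hq]; simp)
  have hrec := aux_recip F H q g r k x3 x4 b hF hq hF0 hg0 hco hrH h3 h4 hk'
  have hF3 : F = (X - C x3) * (H * (X - C x4)) := by rw [hF, hq]; ring
  have hF31 := hsimple x3 _ (Dvd.intro 1 (by rw [mul_one]; exact hF3.symm))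
  have hHx1 : H = (X - C x1) * ((X - C x2) * h) := by rw [hH]; ring
  have hHx2 : H = (X - C x2) * ((X - C x1) * h) := by rw [hH]; ring
  have hHF : H ∣ F := Dvd.intro _ hF.symm
  obtain ⟨c1, d1, hc1, e1, y1, z1, f1⟩ := aux_point F H q _ _ g r k x1 x3 b hb hF hF0 hg0 hq2
    hHx1 (hsimple x1 _ (hHx1 ▸ hHF)) hF3 hF31 hco hrH h3 hk' hrec
  obtain ⟨c2, d2, hc2, e2, y2, z2, f2⟩ := aux_point F H q _ _ g r k x2 x3 b hb hF hF0 hg0 hq2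
    hHx2 (hsimple x2 _ (hHx2 ▸ hHF)) hF3 hF31 hco hrH h3 hk' hrec
  have hH3 : H.eval x3 ≠ 0 := by
    intro h0; apply hF31; rw [eval_mul, h0, zero_mul]
  have hg3 : g.eval x3 ≠ 0 := by
    intro h1
    obtain ⟨a, b, hab⟩ := hco
    have := congrArg (eval x3) hab
    simp [h1, hF3] at this
  have hd1 : d1 ≠ 0 := by rintro rfl; simp [e1] at hc1
  have hd2 : d2 ≠ 0 := by rintro rfl; simp [e2] at hc2
  have eq1 : q.eval x1 = (x1 - x3) * (x1 - x4) := by rw [hq]; simp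
  have eq2 : q.eval x2 = (x2 - x3) * (x2 - x4) := by rw [hq]; simp
  rw [eq1] at e1
  rw [eq2] at e2
  refine ⟨d1 * d2 * (g.eval x3 * H.eval x3), y1 * y2 + b * z1 * z2, y1 * z2 + y2 * z1,
    mul_ne_zero (mul_ne_zero hd1 hd2) (mul_ne_zero hg3 hH3), ?_⟩
  rw [e1] at f1
  rw [e2] at f2
  linear_combination (y2 ^ 2 - b * z2 ^ 2) * f1 + (-((x1 - x3) * (x1 - x4)) * d1 ^ 2 * (eval x3 g * eval x3 H)) * f2

lemma aux_form {E : Type*} [Field E] (hchar : (2 : E) ≠ 0)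
    (hdiv : ∀ f : Polynomial E, f.Monic → Squarefree f → f.natDegree = 4 →
      ∃ g : Polynomial E, IsSquareReflexive g ∧ f ∣ g)
    (b y : E) (hy : y ≠ 0) :
    ∃ d x z : E, (d ≠ 0 ∨ x ≠ 0 ∨ z ≠ 0) ∧ y * d ^ 2 = x ^ 2 - b * z ^ 2 := by
  by_cases hb : IsSquare b
  · obtain ⟨s, rfl⟩ := hb
    exact ⟨0, s, 1, by simp, by ring⟩
  by_cases hy1 : y = 1
  · exact ⟨1, 1, 0, by simp, by rw [hy1]; ring⟩
  have key : ∀ s : E, s ≠ 0 → s ≠ 1 → 1 + y * (s - 1) ≠ 0 →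
      ∃ d x z : E, (d ≠ 0 ∨ x ≠ 0 ∨ z ≠ 0) ∧ y * d ^ 2 = x ^ 2 - b * z ^ 2 := by
    intro s hs0 hs1 hs
    have hs1' : s - 1 ≠ 0 := sub_ne_zero.2 hs1
    obtain ⟨t, ht⟩ : ∃ t, t * (1 + y * (s - 1)) = s := ⟨s / (1 + y * (s - 1)), by field_simp⟩
    have ht0 : t ≠ 0 := by rintro rfl; simp at ht; exact hs0 ht.symm
    obtain ⟨d, x, z, hd, he⟩ := aux_main hdiv b 0 s 1 t hb hs0.symm zero_ne_one ht0.symm hs1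
      (by
        rintro rfl
        have : s * (y * (s - 1)) = 0 := by linear_combination ht
        simp_all)
      (by
        rintro rfl
        have : (y - 1) * (s - 1) = 0 := by linear_combination ht
        rcases mul_eq_zero.1 this with h | h
        · exact hy1 (sub_eq_zero.1 h)
        · exact hs1' h)
    refine ⟨t * (s - 1) * d, x, z, Or.inl (mul_ne_zero (mul_ne_zero ht0 hs1') hd), ?_⟩
    rw [← he]
    linear_combination (t * (s - 1) * d ^ 2) * ht
  by_cases h1 : 1 + y * (-1 - 1) = 0
  · by_cases h3 : (3 : E) = 0
    · by_cases hb1 : b = -1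
      · exact ⟨1, 1, 1, by simp, by rw [hb1]; linear_combination h1 + y * h3 - h3⟩
      · refine key b ?_ ?_ ?_
        · rintro rfl; exact hb IsSquare.zero
        · rintro rfl; exact hb IsSquare.one
        · intro h
          apply hb1
          linear_combination 2 * h + (b - 1) * h1 - h3 + h3
    · refine key 2 hchar ?_ ?_
      · intro h; apply one_ne_zero (α := E); linear_combination h
      · intro h; apply h3; linear_combination 2 * h + h1
  · refine key (-1) (by simp) ?_ h1
    intro h; apply hchar; linear_combination -h

/-- If every monic square-free polynomial of degree 4 over `E` divides a square-reflexive
polynomial, then every 3-dimensional regular quadratic form over `E` is isotropic. -/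
theorem statement9 (E : Type*) [Field E] (hchar : ringChar E ≠ 2)
    (hdiv : ∀ f : Polynomial E, f.Monic → Squarefree f → f.natDegree = 4 →
      ∃ g : Polynomial E, IsSquareReflexive g ∧ f ∣ g)
    (a : Fin 3 → E) (ha : ∀ i, a i ≠ 0) :
    IsotropicDiag a := by
  have h0 := ha 0
  have h2 := ha 2
  obtain ⟨d, x, z, hne, he⟩ := aux_form (Ring.two_ne_zero hchar) hdiv (-(a 1) / a 0) (-(a 2) / a 0)
    (div_ne_zero (neg_ne_zero.2 h2) h0)
  refine ⟨![x, z, d], ?_, ?_⟩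
  · intro h
    have e0 := congrFun h 0
    have e1 := congrFun h 1
    have e2 := congrFun h 2
    simp at e0 e1 e2
    simp_all
  · rw [Fin.sum_univ_three]
    simp
    field_simp at he
    linear_combination -he
end

section
/- Let F be a field of characteristic different from 2 such that every 8-dimensional regular quadratic form over F is isotropic. Let v be a valuation on F with value group ℤ and v(2) = 0, with residue field κ_v. Then every 3-dimensional regular quadratic form over κ_v is isotropic. -/
theorem iso_three {K : Type*} [Field K] (a : Fin 3 → K) (ha : ∀ i, a i ≠ 0)
    (h : IsotropicDiag ![a 0, a 1, a 2, a 0 * a 1 * a 2]) : IsotropicDiag a := by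
  obtain ⟨y, hy, hs⟩ := h
  simp only [Fin.sum_univ_four] at hs
  simp at hs
  have h0 := ha 0
  have key : ∀ p q r : K, (p ≠ 0 ∨ q ≠ 0 ∨ r ≠ 0) →
      a 0 * p ^ 2 + a 1 * q ^ 2 + a 2 * r ^ 2 = 0 → IsotropicDiag a := by
    intro p q r hn he
    refine ⟨![p, q, r], ?_, ?_⟩
    · intro hc
      have e0 := congrFun hc 0
      have e1 := congrFun hc 1
      have e2 := congrFun hc 2
      simp at e0 e1 e2
      tauto
    · simpa [Fin.sum_univ_three] using he
  by_cases hN : y 2 ^ 2 + a 0 * a 1 * y 3 ^ 2 = 0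
  · by_cases hz : y 0 ≠ 0 ∨ y 1 ≠ 0
    · refine key (y 0) (y 1) 0 (by tauto) ?_
      linear_combination hs - a 2 * hN
    · push Not at hz
      refine key (y 2) (a 0 * y 3) 0 ?_ ?_
      · by_contra hc
        push Not at hc
        obtain ⟨c1, c2, -⟩ := hc
        have c3 : y 3 = 0 := by simpa [h0] using c2
        apply hy
        ext i
        fin_cases i
        · exact hz.1
        · exact hz.2
        · exact c1
        · exact c3
      · linear_combination a 0 * hN
  · refine key (y 0 * y 2 + a 1 * y 1 * y 3) (y 1 * y 2 - a 0 * y 0 * y 3)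
      (y 2 ^ 2 + a 0 * a 1 * y 3 ^ 2) (by tauto) ?_
    linear_combination (y 2 ^ 2 + a 0 * a 1 * y 3 ^ 2) * hs

theorem iso_red {R : Type*} [CommRing R] [IsLocalRing R] (A : Fin 4 → R) (p : R)
    (hp : IsLocalRing.residue R p = 0) (y z : Fin 4 → R) (i : Fin 4) (hi : y i = 1)
    (h : ∑ k, A k * y k ^ 2 + p * ∑ k, A k * z k ^ 2 = 0) :
    IsotropicDiag (fun k => IsLocalRing.residue R (A k)) := by
  refine ⟨fun k => IsLocalRing.residue R (y k), ?_, ?_⟩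
  · intro hc
    have := congrFun hc i
    simp [hi] at this
  · have := congrArg (IsLocalRing.residue R) h
    simpa [hp] using this

/-- If every 8-dimensional regular quadratic form over `F` is isotropic and `v` is a
nondyadic ℤ-valuation on `F`, then every 3-dimensional regular quadratic form over the
residue field of `v` is isotropic. -/
theorem statement14 (F : Type*) [Field F] (hchar : ringChar F ≠ 2)
    (hu : ∀ a : Fin 8 → F, (∀ i, a i ≠ 0) → IsotropicDiag a)
    (v : Valuation F (WithZero (Multiplicative ℤ)))
    (hsurj : Function.Surjective v) (hnondyadic : v 2 = 1)
    (a : Fin 3 → IsLocalRing.ResidueField v.valuationSubring)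
    (ha : ∀ i, a i ≠ 0) :
    IsotropicDiag a := by
  apply iso_three a ha
  set b : Fin 4 → IsLocalRing.ResidueField v.valuationSubring :=
    ![a 0, a 1, a 2, a 0 * a 1 * a 2] with hb
  have hb0 : ∀ i, b i ≠ 0 := by
    intro i
    fin_cases i <;> simp [hb, ha]
  choose A hA using fun i => IsLocalRing.residue_surjective (b i)
  have hbA : b = fun k => IsLocalRing.residue _ (A k) := by
    ext k; exact (hA k).symm
  have hA0 : ∀ k, (A k : F) ≠ 0 := by
    intro k hk
    apply hb0 k
    rw [← hA k, show A k = 0 from Subtype.ext hk, map_zero]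
  obtain ⟨π, hπ⟩ := hsurj (WithZero.exp (-1))
  have hπ0 : π ≠ 0 := by
    rintro rfl
    rw [map_zero] at hπ
    exact WithZero.exp_ne_zero hπ.symm
  have hπ1 : v π < 1 := by
    rw [hπ, ← WithZero.exp_zero, WithZero.exp_lt_exp]; norm_num
  have hlt : ∀ t : F, v t < 1 → v t ≤ v π := by
    intro t ht
    by_cases h0 : v t = 0
    · simp [h0]
    · rw [hπ]
      rw [← WithZero.exp_log h0] at ht ⊢
      rw [← WithZero.exp_zero, WithZero.exp_lt_exp] at ht
      rw [WithZero.exp_le_exp]; omega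
  let P : v.valuationSubring := ⟨π, hπ1.le⟩
  have hP : IsLocalRing.residue _ P = 0 := by
    rw [IsLocalRing.residue_eq_zero_iff, IsLocalRing.mem_maximalIdeal, mem_nonunits_iff]
    intro hU
    obtain ⟨Q, hQ⟩ := hU.exists_right_inv
    have h1 : π * (Q : F) = 1 := congrArg Subtype.val hQ
    have h2 : v (Q : F) ≤ 1 := Q.2
    have h3 : v π * v (Q : F) = 1 := by rw [← map_mul, h1, map_one]
    have h4 : v π * v (Q : F) < 1 := mul_lt_one_of_lt_of_le hπ1 h2
    exact h4.ne h3
  obtain ⟨x, hx, hs⟩ := hu (Fin.append (m := 4) (n := 4) (fun k => (A k : F))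
    (fun k => π * A k)) (by
      intro i
      refine Fin.addCases (m := 4) (n := 4) (fun k => ?_) (fun k => ?_) i
      · rw [Fin.append_left]; exact hA0 k
      · rw [Fin.append_right]; exact mul_ne_zero hπ0 (hA0 k))
  have hs' := (Fin.sum_univ_add (a := 4) (b := 4) _).symm.trans hs
  simp only [Fin.append_left, Fin.append_right] at hs'
  obtain ⟨x1, hx1⟩ : ∃ x1 : Fin 4 → F, x1 = fun k => x (Fin.castAdd 4 k) := ⟨_, rfl⟩
  obtain ⟨x2, hx2⟩ : ∃ x2 : Fin 4 → F, x2 = fun k => x (Fin.natAdd 4 k) := ⟨_, rfl⟩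
  have hs2 : ∑ k, (A k : F) * x1 k ^ 2 + π * ∑ k, (A k : F) * x2 k ^ 2 = 0 := by
    rw [Finset.mul_sum, ← hs', hx1, hx2]
    simp only [mul_assoc]
  obtain ⟨i, hi⟩ := Finite.exists_max (fun k => v (x1 k))
  obtain ⟨j, hj⟩ := Finite.exists_max (fun k => v (x2 k))
  rw [hbA]
  rcases le_or_gt (v (x2 j)) (v (x1 i)) with hc | hc
  · have hne : x1 i ≠ 0 := by
      intro h0
      apply hx
      ext l
      rw [h0, map_zero] at hc hi
      refine Fin.addCases (m := 4) (n := 4) (fun k => ?_) (fun k => ?_) l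
      · have := hi k
        rw [hx1] at this
        simpa using this
      · have := (hj k).trans hc
        rw [hx2] at this
        simpa using this
    have hv : 0 < v (x1 i) := by simpa [zero_lt_iff] using hne
    refine iso_red A P hP
      (fun k => ⟨x1 k / x1 i, ?_⟩) (fun k => ⟨x2 k / x1 i, ?_⟩) i
      (Subtype.ext (div_self hne)) ?_
    · rw [Valuation.mem_valuationSubring_iff, map_div₀]
      exact (div_le_one₀ hv).2 (hi k)
    · rw [Valuation.mem_valuationSubring_iff, map_div₀]
      exact (div_le_one₀ hv).2 ((hj k).trans hc)
    · apply Subtype.ext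
      push_cast
      simp only [P, Fin.sum_univ_four] at hs2 ⊢
      field_simp
      linear_combination hs2
  · have hv : 0 < v (x2 j) := lt_of_le_of_lt zero_le hc
    have hne : x2 j ≠ 0 := by
      intro h0
      simp [h0] at hv
    refine iso_red A P hP
      (fun k => ⟨x2 k / x2 j, ?_⟩) (fun k => ⟨x1 k / x2 j / π, ?_⟩) j
      (Subtype.ext (div_self hne)) ?_
    · rw [Valuation.mem_valuationSubring_iff, map_div₀]
      exact (div_le_one₀ hv).2 (hj k)
    · rw [Valuation.mem_valuationSubring_iff, map_div₀]
      refine (div_le_one₀ (by simpa [zero_lt_iff] using hπ0)).2 (hlt _ ?_)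
      rw [map_div₀]
      exact (div_lt_one₀ hv).2 ((hi k).trans_lt hc)
    · apply Subtype.ext
      push_cast
      simp only [P, Fin.sum_univ_four] at hs2 ⊢
      field_simp
      linear_combination hs2
end
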